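/- arXiv:math/0503397 — 3 statements merged into one kernel-verified Lean document; each statement's English description precedes it below -/
import Mathlib

section
/- Let n ≥ 1 and let φ be a continuous valuation on 𝒦(ℝⁿ). Suppose that for every convex body K ∈ 𝒦(ℝⁿ) and every compact set G ⊆ ℝⁿ one has sup_{x ∈ G} |φ(tK + x)| = o(tⁿ) as t → 0⁺ (i.e., for every ε > 0 there is δ > 0 such that |φ(tK + x)| ≤ ε tⁿ for all 0 < t < δ and all x ∈ G). Then φ(K) = 0 for every K ∈ 𝒦(ℝⁿ). -/
open scoped Pointwise ContDiff
open MeasureTheory Set Filter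

noncomputable section

/-- Euclidean space `ℝⁿ`. -/
abbrev Euc (n : ℕ) := EuclideanSpace ℝ (Fin n)

/-- The one-point convex body `{x}`. -/
def ptBody {n : ℕ} (x : Euc n) : ConvexBody (Euc n) :=
  ⟨{x}, convex_singleton x, isCompact_singleton, Set.singleton_nonempty x⟩

/-- The convex body `t • K + x`. -/
def scaleTrans {n : ℕ} (t : ℝ) (x : Euc n) (K : ConvexBody (Euc n)) : ConvexBody (Euc n) :=
  t • K + ptBody x

/-- `φ` is a valuation: whenever `M = K ∪ L` and `N = K ∩ L` are convex bodies,
`φ M + φ N = φ K + φ L`. -/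
def IsValuation {n : ℕ} (φ : ConvexBody (Euc n) → ℂ) : Prop :=
  ∀ K L M N : ConvexBody (Euc n),
    (M : Set (Euc n)) = (K : Set (Euc n)) ∪ (L : Set (Euc n)) →
    (N : Set (Euc n)) = (K : Set (Euc n)) ∩ (L : Set (Euc n)) →
    φ M + φ N = φ K + φ L

namespace ConvexBody

variable {n : ℕ}

/-- The set of points satisfying the integral inequalities `∑ j, a i j * x j ≤ b i`. -/
def polyhedron {ι : Type*} (a : ι → Fin n → ℤ) (b : ι → ℤ) : Set (Euc n) :=
  {x | ∀ i, ∑ j, (a i j : ℝ) * x j ≤ b i}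

theorem convex_polyhedron {ι : Type*} (a : ι → Fin n → ℤ) (b : ι → ℤ) :
    Convex ℝ (polyhedron a b) := by
  intro x hx y hy s t hs ht hst i
  have hxi := mul_le_mul_of_nonneg_left (hx i) hs
  have hyi := mul_le_mul_of_nonneg_left (hy i) ht
  have hlin : ∑ j, (a i j : ℝ) * (s • x + t • y) j =
      s * ∑ j, (a i j : ℝ) * x j + t * ∑ j, (a i j : ℝ) * y j := by
    rw [Finset.mul_sum, Finset.mul_sum, ← Finset.sum_add_distrib]
    refine Finset.sum_congr rfl fun j _ => ?_
    simp only [PiLp.add_apply, PiLp.smul_apply, smul_eq_mul]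
    ring
  have hb : s * (b i : ℝ) + t * b i = b i := by rw [← add_mul, hst, one_mul]
  rw [hlin]
  linarith

theorem isClosed_polyhedron {ι : Type*} (a : ι → Fin n → ℤ) (b : ι → ℤ) :
    IsClosed (polyhedron a b) := by
  simp only [polyhedron, ofPred_forall]
  exact isClosed_iInter fun i => isClosed_le (by fun_prop) continuous_const

/-- The coordinate box with opposite vertices `u` and `v`. -/
def box (u v : Fin n → ℝ) : Set (Euc n) :=
  {x | ∀ j, u j ≤ x j ∧ x j ≤ v j}

theorem convex_box (u v : Fin n → ℝ) : Convex ℝ (box u v) := by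
  intro x hx y hy s t hs ht hst j
  exact convex_Icc (𝕜 := ℝ) (u j) (v j) (hx j) (hy j) hs ht hst

theorem isCompact_box (u v : Fin n → ℝ) : IsCompact (box u v) := by
  have himage : box u v = WithLp.toLp 2 '' Icc u v := by
    ext x
    constructor
    · intro hx
      exact ⟨WithLp.ofLp x, ⟨fun j => (hx j).1, fun j => (hx j).2⟩, rfl⟩
    · rintro ⟨y, hy, rfl⟩ j
      exact ⟨hy.1 j, hy.2 j⟩
  rw [himage]
  exact isCompact_Icc.image (PiLp.continuous_toLp 2 _)

open Classical in
/-- Extension of a functional on convex bodies to all sets by zero; in particular it vanishes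
on the empty set. -/
def extendZero (φ : ConvexBody (Euc n) → ℂ) (A : Set (Euc n)) : ℂ :=
  if h : Convex ℝ A ∧ IsCompact A ∧ A.Nonempty then φ ⟨A, h.1, h.2.1, h.2.2⟩ else 0

theorem extendZero_coe (φ : ConvexBody (Euc n) → ℂ) (K : ConvexBody (Euc n)) :
    extendZero φ (K : Set (Euc n)) = φ K :=
  dif_pos ⟨K.convex, K.isCompact, K.nonempty⟩

theorem extendZero_empty (φ : ConvexBody (Euc n) → ℂ) : extendZero φ ∅ = 0 :=
  dif_neg fun h => h.2.2.ne_empty rfl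

theorem norm_extendZero_le_cut {φ : ConvexBody (Euc n) → ℂ} (hval : IsValuation φ)
    {A : Set (Euc n)} (hconv : Convex ℝ A) (hcomp : IsCompact A) (i : Fin n) (s : ℝ) :
    ‖extendZero φ A‖ ≤ ‖extendZero φ (A ∩ {x | x i ≤ s})‖ +
      ‖extendZero φ (A ∩ {x | s ≤ x i})‖ + ‖extendZero φ (A ∩ {x | x i = s})‖ := by
  have hcoord : Continuous fun x : Euc n => x i := by fun_prop
  rcases (A ∩ {x | x i ≤ s}).eq_empty_or_nonempty with hlow | hlow
  · have hA : A ∩ {x | s ≤ x i} = A := inter_eq_left.2 fun x hx => by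
      by_contra h
      exact notMem_empty x (hlow.subset ⟨hx, show x i ≤ s from (not_le.1 h).le⟩)
    rw [hA]
    linarith [norm_nonneg (extendZero φ (A ∩ {x | x i ≤ s})),
      norm_nonneg (extendZero φ (A ∩ {x | x i = s}))]
  rcases (A ∩ {x | s ≤ x i}).eq_empty_or_nonempty with hupp | hupp
  · have hA : A ∩ {x | x i ≤ s} = A := inter_eq_left.2 fun x hx => by
      by_contra h
      exact notMem_empty x (hupp.subset ⟨hx, show s ≤ x i from (not_le.1 h).le⟩)
    rw [hA]
    linarith [norm_nonneg (extendZero φ (A ∩ {x | s ≤ x i})),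
      norm_nonneg (extendZero φ (A ∩ {x | x i = s}))]
  have hmid : (A ∩ {x | x i = s}).Nonempty := by
    obtain ⟨x, hxA, hx⟩ := hlow
    obtain ⟨y, hyA, hy⟩ := hupp
    obtain ⟨z, hzA, hz⟩ :=
      hconv.isPreconnected.intermediate_value hxA hyA hcoord.continuousOn ⟨hx, hy⟩
    exact ⟨z, hzA, hz⟩
  have hconv_coord {I : Set ℝ} (hI : Convex ℝ I) : Convex ℝ (A ∩ {x | x i ∈ I}) :=
    hconv.inter fun x hx y hy _ _ ha hb hab => hI hx hy ha hb hab
  let L : ConvexBody (Euc n) := ⟨_, hconv_coord (convex_Iic s),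
    hcomp.inter_right (isClosed_le hcoord continuous_const), hlow⟩
  let U : ConvexBody (Euc n) := ⟨_, hconv_coord (convex_Ici s),
    hcomp.inter_right (isClosed_le continuous_const hcoord), hupp⟩
  let W : ConvexBody (Euc n) := ⟨_, hconv_coord (convex_singleton s),
    hcomp.inter_right (isClosed_eq hcoord continuous_const), hmid⟩
  let T : ConvexBody (Euc n) := ⟨A, hconv, hcomp, hlow.mono inter_subset_left⟩
  have hsum : φ T + φ W = φ L + φ U := by
    refine hval L U T W ?_ ?_
    · change A = A ∩ {x | x i ≤ s} ∪ A ∩ {x | s ≤ x i}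
      ext x
      simp only [mem_union, mem_inter_iff, mem_ofPred_eq, ← and_or_left, le_total, and_true]
    · change A ∩ {x | x i = s} = A ∩ {x | x i ≤ s} ∩ (A ∩ {x | s ≤ x i})
      ext x
      simp only [mem_inter_iff, mem_ofPred_eq, le_antisymm_iff]
      tauto
  change ‖extendZero φ (T : Set (Euc n))‖ ≤ ‖extendZero φ (L : Set (Euc n))‖ +
    ‖extendZero φ (U : Set (Euc n))‖ + ‖extendZero φ (W : Set (Euc n))‖
  simp only [extendZero_coe]
  rw [eq_sub_of_add_eq hsum]
  exact (norm_sub_le _ _).trans (add_le_add_left (norm_add_le _ _) _)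

/-- The slab `t * z ≤ x i ≤ t * (z + 1)` (for `e = true`) or its lower wall `x i = t * z`
(for `e = false`). -/
def slab (t : ℝ) (i : Fin n) (z : ℤ) (e : Bool) : Set (Euc n) :=
  {x | t * z ≤ x i ∧ x i ≤ t * (z + if e then 1 else 0)}

theorem convex_slab (t : ℝ) (i : Fin n) (z : ℤ) (e : Bool) : Convex ℝ (slab t i z e) :=
  fun _ hx _ hy _ _ ha hb hab => convex_Icc (𝕜 := ℝ) _ _ hx hy ha hb hab

theorem isClosed_slab (t : ℝ) (i : Fin n) (z : ℤ) (e : Bool) : IsClosed (slab t i z e) :=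
  isClosed_Icc.preimage (f := fun x : Euc n => x i) (by fun_prop)

theorem norm_extendZero_le_of_slabs {φ : ConvexBody (Euc n) → ℂ} (hval : IsValuation φ)
    {A : Set (Euc n)} (hconv : Convex ℝ A) (hcomp : IsCompact A) {i : Fin n} {t η : ℝ}
    (ht : 0 ≤ t) (hη : ∀ z e, ‖extendZero φ (A ∩ slab t i z e)‖ ≤ η) (z : ℤ) (m : ℕ)
    (hA : ∀ x ∈ A, t * z ≤ x i ∧ x i ≤ t * (z + m)) :
    ‖extendZero φ A‖ ≤ (2 * m + 1) * η := by
  have hstrip : ∀ k : ℕ, ‖extendZero φ (A ∩ {x | t * z ≤ x i ∧ x i ≤ t * (z + k)})‖ ≤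
      (2 * k + 1) * η := by
    intro k
    induction k with
    | zero => simpa [slab] using hη z false
    | succ k ih =>
      have hstrip_eq : {x : Euc n | t * z ≤ x i ∧ x i ≤ t * (z + (k + 1 : ℕ))} =
          (fun x : Euc n => x i) ⁻¹' Icc (t * z) (t * (z + (k + 1 : ℕ))) := rfl
      have hcoord : Continuous fun x : Euc n => x i := by fun_prop
      have hcut := norm_extendZero_le_cut hval
        (A := A ∩ {x | t * z ≤ x i ∧ x i ≤ t * (z + (k + 1 : ℕ))})
        (hconv.inter fun _ hx _ hy _ _ ha hb hab => convex_Icc (𝕜 := ℝ) _ _ hx hy ha hb hab)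
        (hcomp.inter_right (hstrip_eq ▸ isClosed_Icc.preimage hcoord)) i (t * (z + k))
      have hk : 0 ≤ t * k := by positivity
      have hlow : A ∩ {x | t * z ≤ x i ∧ x i ≤ t * (z + (k + 1 : ℕ))} ∩ {x | x i ≤ t * (z + k)} =
          A ∩ {x | t * z ≤ x i ∧ x i ≤ t * (z + k)} := by
        ext x
        simp only [mem_inter_iff, mem_ofPred_eq, Nat.cast_succ]
        refine ⟨fun h => ⟨h.1.1, h.1.2.1, h.2⟩, fun h => ⟨⟨h.1, h.2.1, ?_⟩, h.2.2⟩⟩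
        linarith [h.2.2]
      have hupp : A ∩ {x | t * z ≤ x i ∧ x i ≤ t * (z + (k + 1 : ℕ))} ∩ {x | t * (z + k) ≤ x i} =
          A ∩ slab t i (z + k) true := by
        ext x
        simp only [mem_inter_iff, mem_ofPred_eq, slab, Nat.cast_succ, Int.cast_add,
          Int.cast_natCast, if_true]
        refine ⟨fun h => ⟨h.1.1, h.2, ?_⟩, fun h => ⟨⟨h.1, ?_, ?_⟩, h.2.1⟩⟩
        · linarith [h.1.2.2]
        · linarith [h.2.1]
        · linarith [h.2.2]
      have hmid : A ∩ {x | t * z ≤ x i ∧ x i ≤ t * (z + (k + 1 : ℕ))} ∩ {x | x i = t * (z + k)} =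
          A ∩ slab t i (z + k) false := by
        ext x
        simp only [mem_inter_iff, mem_ofPred_eq, slab, Nat.cast_succ, Int.cast_add,
          Int.cast_natCast, Bool.false_eq_true, if_false, add_zero]
        refine ⟨fun h => ⟨h.1.1, h.2.ge, h.2.le⟩,
          fun h => ⟨⟨h.1, ?_, ?_⟩, le_antisymm h.2.2 h.2.1⟩⟩
        · linarith [h.2.1]
        · linarith [h.2.2]
      rw [hlow, hupp, hmid] at hcut
      refine hcut.trans ?_
      rw [Nat.cast_succ]
      linarith [hη (z + k) true, hη (z + k) false]
  have hinter : A ∩ {x | t * z ≤ x i ∧ x i ≤ t * (z + m)} = A := inter_eq_left.2 hA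
  exact hinter ▸ hstrip m

theorem norm_extendZero_le_of_cells {φ : ConvexBody (Euc n) → ℂ} (hval : IsValuation φ)
    {t η : ℝ} (ht : 0 ≤ t) (z₀ : ℤ) (m : ℕ) (T : Finset (Fin n)) :
    ∀ {A : Set (Euc n)}, Convex ℝ A → IsCompact A →
      (∀ x ∈ A, ∀ i, t * z₀ ≤ x i ∧ x i ≤ t * (z₀ + m)) →
      (∀ (z : Fin n → ℤ) (e : Fin n → Bool),
        ‖extendZero φ (A ∩ {x | ∀ i ∈ T, x ∈ slab t i (z i) (e i)})‖ ≤ η) →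
      ‖extendZero φ A‖ ≤ (2 * m + 1) ^ T.card * η := by
  induction T using Finset.induction_on with
  | empty =>
    intro A _ _ _ h
    simpa using h 0 fun _ => true
  | insert i T hi ih =>
    intro A hconv hcomp hA h
    rw [Finset.card_insert_of_notMem hi, pow_succ', mul_assoc]
    refine norm_extendZero_le_of_slabs hval hconv hcomp ht (fun z e => ?_) z₀ m
      fun x hx => hA x hx i
    refine ih (hconv.inter (convex_slab ..)) (hcomp.inter_right (isClosed_slab ..))
      (fun x hx => hA x hx.1) fun z' e' => ?_
    convert h (Function.update z' i z) (Function.update e' i e) using 3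
    ext x
    simp only [mem_inter_iff, mem_ofPred_eq, Finset.forall_mem_insert, Function.update_self,
      and_assoc]
    refine and_congr_right fun _ => and_congr_right fun _ => forall₂_congr fun j hj => ?_
    have hji : j ≠ i := fun h => hi (h ▸ hj)
    simp only [Function.update_of_ne hji]

/-- The part of a face of the unit cube cut out by integral inequalities. -/
def cubeCell {ι : Type*} (a : ι → Fin n → ℤ) (e : Fin n → Bool) (c : ι → ℤ) : Set (Euc n) :=
  box 0 (fun j => if e j then 1 else 0) ∩ polyhedron a c

theorem eventually_norm_extendZero_cubeCell_le {φ : ConvexBody (Euc n) → ℂ}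
    (hsmall : ∀ (K : ConvexBody (Euc n)) (G : Set (Euc n)), IsCompact G →
      ∀ ε : ℝ, 0 < ε → ∃ δ : ℝ, 0 < δ ∧ ∀ t : ℝ, 0 < t → t < δ → ∀ x ∈ G,
        ‖φ (scaleTrans t x K)‖ ≤ ε * t ^ n)
    {ι : Type*} [Finite ι] (a : ι → Fin n → ℤ) (M : ℤ) {G : Set (Euc n)} (hG : IsCompact G)
    {ε : ℝ} (hε : 0 < ε) :
    ∀ᶠ t : ℝ in nhdsWithin 0 (Ioi 0), ∀ (e : Fin n → Bool) (c : ι → Icc (-M - 1) M), ∀ x ∈ G,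
      ‖extendZero φ (t • cubeCell a e (fun i => c i) + {x})‖ ≤ ε * t ^ n := by
  simp only [Filter.eventually_all]
  intro e c
  rcases (cubeCell a e fun i => c i).eq_empty_or_nonempty with hQ | hQ
  · filter_upwards [self_mem_nhdsWithin] with t ht x _
    rw [hQ, smul_set_empty, empty_add, extendZero_empty, norm_zero]
    exact mul_nonneg hε.le (pow_nonneg (le_of_lt ht) n)
  · let Q : ConvexBody (Euc n) := ⟨_, (convex_box _ _).inter (convex_polyhedron a _),
      (isCompact_box _ _).inter_right (isClosed_polyhedron a _), hQ⟩
    obtain ⟨δ, hδ, h⟩ := hsmall Q G hG ε hε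
    filter_upwards [Ioo_mem_nhdsGT hδ] with t ht x hx
    have := h t ht.1 ht.2 x hx
    rwa [← extendZero_coe φ] at this

theorem inter_slabs_eq_cubeCell {ι : Type*} (a : ι → Fin n → ℤ) (b : ι → ℤ) {N : ℕ}
    (hN : 0 < N) (z : Fin n → ℤ) (e : Fin n → Bool) :
    polyhedron a b ∩ {x | ∀ i ∈ Finset.univ, x ∈ slab (N : ℝ)⁻¹ i (z i) (e i)} =
      (N : ℝ)⁻¹ • cubeCell a e (fun i => N * b i - ∑ j, a i j * z j) +
        {WithLp.toLp 2 fun j => (N : ℝ)⁻¹ * z j} := by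
  have hN' : (0 : ℝ) < N := by exact_mod_cast hN
  have hN_ne := hN'.ne'
  ext x
  rw [add_singleton, mem_image]
  simp only [mem_smul_set, exists_exists_and_eq_and]
  constructor
  · rintro ⟨hP, hS⟩
    refine ⟨WithLp.toLp 2 fun j => N * x j - z j, ⟨fun j => ?_, fun i => ?_⟩, ?_⟩
    · have h := hS j (Finset.mem_univ j)
      simp only [slab, mem_ofPred_eq] at h
      rw [inv_mul_le_iff₀ hN', le_inv_mul_iff₀ hN'] at h
      simp only [Pi.zero_apply]
      constructor <;> linarith [h.1, h.2]
    · have h := mul_le_mul_of_nonneg_left (hP i) hN'.le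
      push_cast
      simp only [mul_sub, Finset.sum_sub_distrib]
      rw [Finset.mul_sum] at h
      have : ∑ j, (a i j : ℝ) * (N * x j) = ∑ j, (N : ℝ) * (a i j * x j) :=
        Finset.sum_congr rfl fun j _ => by ring
      linarith
    · ext j
      simp only [PiLp.add_apply, PiLp.smul_apply, smul_eq_mul]
      field_simp
      ring
  · rintro ⟨y, ⟨hbox, hpoly⟩, rfl⟩
    refine ⟨fun i => ?_, fun j _ => ?_⟩
    · have h := hpoly i
      push_cast at h
      refine le_of_mul_le_mul_left ?_ hN'
      rw [Finset.mul_sum]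
      have : ∑ j, (N : ℝ) * ((a i j : ℝ) *
            ((N : ℝ)⁻¹ • y + WithLp.toLp 2 fun j => (N : ℝ)⁻¹ * z j : Euc n) j) =
          ∑ j, (a i j : ℝ) * y j + ∑ j, (a i j : ℝ) * z j := by
        rw [← Finset.sum_add_distrib]
        refine Finset.sum_congr rfl fun j _ => ?_
        simp only [PiLp.add_apply, PiLp.smul_apply, smul_eq_mul]
        field_simp
      linarith
    · have h := hbox j
      simp only [slab, mem_ofPred_eq, PiLp.add_apply, PiLp.smul_apply, smul_eq_mul, ← mul_add,
        Pi.zero_apply] at h ⊢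
      constructor <;> refine mul_le_mul_of_nonneg_left ?_ (inv_nonneg.2 hN'.le) <;> linarith

theorem exists_cubeCell_eq_of_bounded {ι : Type*} (a : ι → Fin n → ℤ) {M : ℤ}
    (hM : ∀ i, ∑ j, |a i j| ≤ M) (hM_nonneg : 0 ≤ M) (e : Fin n → Bool) (c : ι → ℤ) :
    ∃ c' : ι → Icc (-M - 1) M, cubeCell a e c = cubeCell a e fun i => c' i := by
  refine ⟨fun i => ⟨max (-M - 1) (min M (c i)), le_max_left _ _,
    max_le (by omega) (min_le_left _ _)⟩, ?_⟩
  ext y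
  refine and_congr_right fun hy => forall_congr' fun i => ?_
  have habs : |∑ j, (a i j : ℝ) * y j| ≤ M := by
    refine (Finset.abs_sum_le_sum_abs _ _).trans (le_trans ?_ (Int.cast_le.2 (hM i)))
    push_cast
    refine Finset.sum_le_sum fun j _ => ?_
    rw [abs_mul]
    refine mul_le_of_le_one_right (abs_nonneg _) (abs_le.2 ?_)
    have h := hy j
    simp only [Pi.zero_apply] at h
    refine ⟨by linarith [h.1], h.2.trans ?_⟩
    split_ifs <;> norm_num
  rw [abs_le] at habs
  push_cast
  rw [le_max_iff, le_min_iff]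
  constructor
  · exact fun h => Or.inr ⟨habs.2, h⟩
  · rintro (h | h)
    · linarith [habs.1]
    · exact h.2

theorem eq_zero_of_coe_eq_polyhedron {φ : ConvexBody (Euc n) → ℂ} (hval : IsValuation φ)
    (hsmall : ∀ (K : ConvexBody (Euc n)) (G : Set (Euc n)), IsCompact G →
      ∀ ε : ℝ, 0 < ε → ∃ δ : ℝ, 0 < δ ∧ ∀ t : ℝ, 0 < t → t < δ → ∀ x ∈ G,
        ‖φ (scaleTrans t x K)‖ ≤ ε * t ^ n)
    {ι : Type*} [Fintype ι] (a : ι → Fin n → ℤ) (b : ι → ℤ) {K : ConvexBody (Euc n)}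
    (hK : (K : Set (Euc n)) = polyhedron a b) : φ K = 0 := by
  obtain ⟨R, hR⟩ : ∃ R : ℕ, ∀ x ∈ K, ∀ j, |x j| ≤ R := by
    obtain ⟨r, hr⟩ := K.isBounded.exists_norm_le
    obtain ⟨R, hR⟩ := exists_nat_ge r
    exact ⟨R, fun x hx j => (PiLp.norm_apply_le x j).trans ((hr x hx).trans hR)⟩
  let M : ℤ := ∑ i, ∑ j, |a i j|
  have hM : ∀ i, ∑ j, |a i j| ≤ M := fun i =>
    Finset.single_le_sum (f := fun i => ∑ j, |a i j|)
      (fun i _ => Finset.sum_nonneg fun j _ => abs_nonneg _) (Finset.mem_univ i)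
  have hM_nonneg : 0 ≤ M := Finset.sum_nonneg fun i _ => Finset.sum_nonneg fun j _ => abs_nonneg _
  have hbound : ∀ ε : ℝ, 0 < ε → ‖φ K‖ ≤ (4 * R + 1) ^ n * ε := by
    intro ε hε
    have hev := eventually_norm_extendZero_cubeCell_le hsmall a M
      (isCompact_box (fun _ : Fin n => -(R + 1 : ℝ)) fun _ => (R + 1 : ℝ)) hε
    have hlim : Tendsto (fun N : ℕ => (N : ℝ)⁻¹) atTop (nhdsWithin 0 (Ioi 0)) :=
      tendsto_inv_atTop_nhdsGT_zero.comp tendsto_natCast_atTop_atTop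
    obtain ⟨N, hcell, hN⟩ := ((hlim.eventually hev).and (eventually_gt_atTop 0)).exists
    have hN' : (1 : ℝ) ≤ N := by exact_mod_cast hN
    have hN_pos : (0 : ℝ) < N := by linarith
    have hNinv : (N : ℝ)⁻¹ ≤ 1 := inv_le_one_of_one_le₀ hN'
    have key := norm_extendZero_le_of_cells hval (t := (N : ℝ)⁻¹) (η := ε * (N : ℝ)⁻¹ ^ n)
      (by positivity) (-(R * N)) (2 * (R * N)) Finset.univ K.convex K.isCompact ?_ ?_
    · rw [extendZero_coe, Finset.card_univ, Fintype.card_fin] at key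
      refine key.trans ?_
      have hfactor : (2 * ((2 * (R * N) : ℕ) : ℝ) + 1) * (N : ℝ)⁻¹ ≤ 4 * R + 1 := by
        push_cast
        have : (2 * (2 * ((R : ℝ) * N)) + 1) * (N : ℝ)⁻¹ = 4 * R + (N : ℝ)⁻¹ := by
          field_simp
          ring
        linarith
      calc (2 * ((2 * (R * N) : ℕ) : ℝ) + 1) ^ n * (ε * (N : ℝ)⁻¹ ^ n)
          = ((2 * ((2 * (R * N) : ℕ) : ℝ) + 1) * (N : ℝ)⁻¹) ^ n * ε := by rw [mul_pow]; ring
        _ ≤ (4 * R + 1) ^ n * ε := by gcongr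
    · intro x hx j
      have h := abs_le.1 (hR x hx j)
      rw [inv_mul_le_iff₀ hN_pos, le_inv_mul_iff₀ hN_pos]
      push_cast
      constructor <;> nlinarith [h.1, h.2]
    · intro z e
      rcases ((K : Set (Euc n)) ∩
        {x | ∀ i ∈ Finset.univ, x ∈ slab (N : ℝ)⁻¹ i (z i) (e i)}).eq_empty_or_nonempty
        with hempty | ⟨x, hx, hxs⟩
      · rw [hempty, extendZero_empty, norm_zero]
        positivity
      obtain ⟨c, hc⟩ := exists_cubeCell_eq_of_bounded a hM hM_nonneg e
        fun i => N * b i - ∑ j, a i j * z j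
      rw [hK, inter_slabs_eq_cubeCell a b hN, hc]
      refine hcell e c _ fun j => ?_
      have h := abs_le.1 (hR x hx j)
      have hs := hxs j (Finset.mem_univ j)
      simp only [slab, mem_ofPred_eq, mul_add] at hs
      have he : (N : ℝ)⁻¹ * (if e j then (1 : ℝ) else 0) ≤ 1 := by split_ifs <;> simp [hNinv]
      constructor
      · change -(R + 1 : ℝ) ≤ (N : ℝ)⁻¹ * z j
        linarith [h.1, hs.2]
      · change (N : ℝ)⁻¹ * z j ≤ (R + 1 : ℝ)
        linarith [h.2, hs.1]
  rw [← norm_eq_zero]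
  refine le_antisymm (le_of_forall_pos_le_add fun ε hε => ?_) (norm_nonneg _)
  have hC : (0 : ℝ) < (4 * R + 1) ^ n := by positivity
  refine (hbound (ε / (4 * R + 1) ^ n) (by positivity)).trans (le_of_eq ?_)
  field_simp
  ring

theorem exists_integral_separation (K : ConvexBody (Euc n)) {x : Euc n} (hx : x ∉ K) :
    ∃ (a : Fin n → ℤ) (b : ℤ), (∀ y ∈ K, ∑ j, (a j : ℝ) * y j ≤ b) ∧
      (b : ℝ) < ∑ j, (a j : ℝ) * x j := by
  obtain ⟨f, u, hfK, hfx⟩ := geometric_hahn_banach_closed_point K.convex K.isClosed hx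
  have hf : ∀ y : Euc n, f y = ∑ j, f (EuclideanSpace.single j 1) * y j := by
    intro y
    conv_lhs => rw [← (EuclideanSpace.basisFun (Fin n) ℝ).sum_repr y]
    simp [mul_comm]
  have hcomp : IsCompact (insert x (K : Set (Euc n))) := K.isCompact.insert x
  obtain ⟨C, hC⟩ := hcomp.bddAbove_image
    (f := fun y : Euc n => ∑ j, |y j|) (by fun_prop)
  have hC' : ∀ y ∈ insert x (K : Set (Euc n)), ∑ j, |y j| ≤ C :=
    fun y hy => hC (mem_image_of_mem _ hy)
  obtain ⟨D, hD⟩ := exists_nat_gt ((2 * C + 1) / (f x - u))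
  rw [div_lt_iff₀ (sub_pos.2 hfx)] at hD
  have happrox : ∀ y ∈ insert x (K : Set (Euc n)),
      |∑ j, (⌊D * f (EuclideanSpace.single j 1)⌋ : ℝ) * y j - D * f y| ≤ C := by
    intro y hy
    rw [hf y, Finset.mul_sum, ← Finset.sum_sub_distrib]
    refine (Finset.abs_sum_le_sum_abs _ _).trans
      ((Finset.sum_le_sum fun j _ => ?_).trans (hC' y hy))
    rw [← mul_assoc, ← sub_mul, abs_mul]
    refine mul_le_of_le_one_left (abs_nonneg _) (abs_le.2 ?_)
    have h₁ := Int.floor_le (D * f (EuclideanSpace.single j 1))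
    have h₂ := Int.lt_floor_add_one (D * f (EuclideanSpace.single j 1))
    constructor <;> linarith
  refine ⟨fun j => ⌊D * f (EuclideanSpace.single j 1)⌋, ⌈D * u + C⌉, fun y hy => ?_, ?_⟩
  · have h₁ := (abs_le.1 (happrox y (mem_insert_of_mem x hy))).2
    have h₂ : (D : ℝ) * f y ≤ D * u := mul_le_mul_of_nonneg_left (hfK y hy).le D.cast_nonneg
    exact le_trans (by linarith) (Int.le_ceil _)
  · have h₁ := (abs_le.1 (happrox x (mem_insert x _))).1
    have h₂ := Int.ceil_lt_add_one (D * u + C)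
    linarith

theorem exists_polyhedron_approximation (K : ConvexBody (Euc n)) {ε : ℝ} (hε : 0 < ε) :
    ∃ (ι : Type) (_ : Fintype ι) (a : ι → Fin n → ℤ) (b : ι → ℤ) (P : ConvexBody (Euc n)),
      (P : Set (Euc n)) = polyhedron a b ∧ dist P K ≤ ε := by
  have hcont : Continuous fun x : Euc n => Metric.infDist x (K : Set (Euc n)) :=
    Metric.continuous_infDist_pt _
  have hsub : {x | Metric.infDist x (K : Set (Euc n)) ≤ ε} ⊆
      Metric.cthickening ε (K : Set (Euc n)) := by
    intro x hx
    obtain ⟨y, hy, hxy⟩ := K.isCompact.exists_infDist_eq_dist K.nonempty x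
    exact Metric.mem_cthickening_of_dist_le x y ε _ hy (hxy ▸ hx)
  let F : Set (Euc n) := {x | Metric.infDist x (K : Set (Euc n)) = ε}
  have hF : IsCompact F := K.isCompact.cthickening.of_isClosed_subset
    (isClosed_eq hcont continuous_const) fun x hx => hsub (le_of_eq hx)
  have hsep : ∀ x : F, ∃ (a : Fin n → ℤ) (b : ℤ), (∀ y ∈ K, ∑ j, (a j : ℝ) * y j ≤ b) ∧
      (b : ℝ) < ∑ j, (a j : ℝ) * (x : Euc n) j := fun ⟨x, hx⟩ =>
    exists_integral_separation K fun hxK => hε.ne' <| by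
      rw [← (hx : Metric.infDist x (K : Set (Euc n)) = ε), Metric.infDist_zero_of_mem hxK]
  choose a b hK hx using hsep
  obtain ⟨T, hT⟩ := hF.elim_finite_subcover
    (fun p : F => {x : Euc n | (b p : ℝ) < ∑ j, (a p j : ℝ) * x j})
    (fun p => isOpen_lt continuous_const (by fun_prop))
    fun x hxF => mem_iUnion.2 ⟨⟨x, hxF⟩, hx ⟨x, hxF⟩⟩
  let A : Set (Euc n) := polyhedron (fun p : T => a p) fun p : T => b p
  have hKA : (K : Set (Euc n)) ⊆ A := fun y hy p => hK p y hy
  have hA : ∀ x ∈ A, Metric.infDist x (K : Set (Euc n)) ≤ ε := by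
    intro x hxA
    by_contra! hlt
    obtain ⟨k, hk⟩ := K.nonempty
    obtain ⟨z, hzA, hz⟩ := (convex_polyhedron _ _).isPreconnected.intermediate_value
      (hKA hk) hxA hcont.continuousOn
      ⟨(Metric.infDist_zero_of_mem hk).trans_le hε.le, hlt.le⟩
    obtain ⟨p, hp, hzp⟩ := mem_iUnion₂.1 (hT hz)
    exact not_le.2 hzp (hzA ⟨p, hp⟩)
  let P : ConvexBody (Euc n) := ⟨A, convex_polyhedron _ _,
    K.isCompact.cthickening.of_isClosed_subset (isClosed_polyhedron _ _)
      fun x hxA => hsub (hA x hxA), K.nonempty.mono hKA⟩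
  refine ⟨T, inferInstance, _, _, P, rfl, Metric.hausdorffDist_le_of_infDist hε.le hA ?_⟩
  intro x hxK
  exact (Metric.infDist_zero_of_mem (hKA hxK)).trans_le hε.le

end ConvexBody

/-- If a continuous valuation `φ` on `𝒦(ℝⁿ)` satisfies
`sup_{x ∈ G} |φ(tK + x)| = o(tⁿ)` as `t → 0⁺` for every convex body `K` and compact `G`,
then `φ ≡ 0`. -/
theorem vanishing_of_small_at_scale_n {n : ℕ} (hn : 1 ≤ n)
    (φ : ConvexBody (Euc n) → ℂ) (hval : IsValuation φ) (hcont : Continuous φ)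
    (hsmall : ∀ (K : ConvexBody (Euc n)) (G : Set (Euc n)), IsCompact G →
      ∀ ε : ℝ, 0 < ε → ∃ δ : ℝ, 0 < δ ∧ ∀ t : ℝ, 0 < t → t < δ → ∀ x ∈ G,
        ‖φ (scaleTrans t x K)‖ ≤ ε * t ^ n) :
    ∀ K : ConvexBody (Euc n), φ K = 0 := by
  have hdense : Dense {K | φ K = 0} := by
    intro K
    refine Metric.mem_closure_iff.2 fun ε hε => ?_
    obtain ⟨ι, _, a, b, P, hP, hdist⟩ := K.exists_polyhedron_approximation (half_pos hε)
    refine ⟨P, ConvexBody.eq_zero_of_coe_eq_polyhedron hval hsmall a b hP, ?_⟩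
    rw [dist_comm]
    linarith
  intro K
  have hclosed : IsClosed {K | φ K = 0} := isClosed_eq hcont continuous_const
  exact hclosed.closure_subset (hdense K)
end
end

section
/- Let n ≥ 1 and let φ be a continuous valuation on 𝒦(ℝⁿ). Assume: (a) for every convex body K, the function (t, x) ↦ φ(tK + x) is C^∞ on [0,1] × ℝⁿ; (b) for every K and x, the partial derivatives ∂^k/∂t^k φ(tK + x)|_{t=0} vanish for all k < n; (c) for every x ∈ ℝⁿ, the map K ↦ ∂ⁿ/∂tⁿ φ(tK + x)|_{t=0} is continuous on 𝒦(ℝⁿ) with respect to the Hausdorff metric. Then there exists a C^∞ function f : ℝⁿ → ℂ such that φ(K) = ∫_K f(x) dx for every convex body K, where the integral is with respect to Lebesgue measure. -/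
open scoped Pointwise ContDiff
open MeasureTheory Set Filter

noncomputable section

section Taylor

variable {E : Type*} [NormedAddCommGroup E] [NormedSpace ℝ E]

theorem contDiffOn_iteratedDerivWithin_fst {F : ℝ × E → ℂ}
    (hF : ContDiffOn ℝ ∞ F (Icc 0 1 ×ˢ (univ : Set E))) (k : ℕ) :
    ContDiffOn ℝ ∞ (fun p : ℝ × E => iteratedDerivWithin k (fun t => F (t, p.2)) (Icc 0 1) p.1)
      (Icc 0 1 ×ˢ (univ : Set E)) := by
  have hU : UniqueDiffOn ℝ (Icc (0 : ℝ) 1) := uniqueDiffOn_Icc one_pos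
  induction k with
  | zero => simpa using hF
  | succ k ih =>
    set G : ℝ × E → ℂ :=
      fun p => iteratedDerivWithin k (fun t => F (t, p.2)) (Icc 0 1) p.1 with hG
    have h1 : ContDiffOn ℝ ∞ (fun p => fderivWithin ℝ G (Icc 0 1 ×ˢ (univ : Set E)) p (1, 0))
        (Icc 0 1 ×ˢ (univ : Set E)) :=
      (ih.fderivWithin (hU.prod uniqueDiffOn_univ) (by simp)).clm_apply contDiffOn_const
    refine h1.congr ?_
    rintro ⟨t, x⟩ ⟨ht, -⟩
    rw [iteratedDerivWithin_succ]
    have hd : HasFDerivWithinAt G (fderivWithin ℝ G (Icc 0 1 ×ˢ (univ : Set E)) (t, x))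
        (Icc 0 1 ×ˢ (univ : Set E)) (t, x) :=
      ((ih.differentiableOn (by simp)) (t, x) ⟨ht, mem_univ _⟩).hasFDerivWithinAt
    have hc : HasDerivWithinAt (fun s : ℝ => (s, x)) ((1 : ℝ), (0 : E)) (Icc 0 1) t :=
      (hasDerivWithinAt_id t _).prodMk (hasDerivWithinAt_const t _ x)
    have := HasFDerivWithinAt.comp_hasDerivWithinAt (t := Icc 0 1 ×ˢ (univ : Set E)) t hd hc
      (fun s hs => ⟨hs, mem_univ _⟩)
    exact this.derivWithin (hU t ht)

theorem exists_smooth_leading_coeff [ProperSpace E] {F : ℝ × E → ℂ} (n : ℕ)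
    (hF : ContDiffOn ℝ ∞ F (Icc 0 1 ×ˢ (univ : Set E)))
    (hvan : ∀ x : E, ∀ k < n, iteratedDerivWithin k (fun t => F (t, x)) (Ici 0) 0 = 0) :
    ∃ f : E → ℂ, ContDiff ℝ ∞ f ∧ ∀ R : ℝ, ∃ C : ℝ, 0 ≤ C ∧ ∀ x : E, ‖x‖ ≤ R →
      ∀ t ∈ Icc (0 : ℝ) 1, ‖F (t, x) - (t : ℂ) ^ n * f x‖ ≤ C * t ^ (n + 1) := by
  have hvan' : ∀ x : E, ∀ k < n, iteratedDerivWithin k (fun t => F (t, x)) (Icc 0 1) 0 = 0 := by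
    intro x k hk
    rw [← hvan x k hk, iteratedDerivWithin, iteratedDerivWithin, iteratedFDerivWithin_congr_set]
    filter_upwards [Iio_mem_nhds (zero_lt_one : (0 : ℝ) < 1)] with t ht
    exact propext ⟨fun h => h.1, fun h => ⟨h, le_of_lt ht⟩⟩
  refine ⟨fun x => ((n.factorial : ℂ)⁻¹) *
    iteratedDerivWithin n (fun t => F (t, x)) (Icc 0 1) 0, ?_, fun R => ?_⟩
  · refine contDiff_const.mul ?_
    have h := (contDiffOn_iteratedDerivWithin_fst hF n).comp
      (g := fun p : ℝ × E => iteratedDerivWithin n (fun t => F (t, p.2)) (Icc 0 1) p.1)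
      (f := fun x : E => ((0 : ℝ), x)) (s := univ)
      (contDiff_const.prodMk contDiff_id).contDiffOn (fun x _ => ⟨by simp, mem_univ _⟩)
    exact contDiffOn_univ.1 h
  · have hcont := (contDiffOn_iteratedDerivWithin_fst hF (n + 1)).continuousOn
    obtain ⟨C, hC⟩ := (isCompact_Icc.prod (isCompact_closedBall (0 : E) R)).exists_bound_of_continuousOn
      (hcont.mono (prod_mono (le_refl (Icc (0 : ℝ) 1)) (subset_univ _)))
    refine ⟨max C 0, le_max_right _ _, fun x hx t ht => ?_⟩
    have hsm : ContDiffOn ℝ (n + 1) (fun t => F (t, x)) (Icc 0 1) := by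
      refine ContDiffOn.of_le (n := ∞) ?_ (by exact_mod_cast le_top)
      exact hF.comp (f := fun t : ℝ => (t, x)) (contDiff_id.prodMk contDiff_const).contDiffOn
        (fun s hs => ⟨hs, mem_univ _⟩)
    have hb := taylor_mean_remainder_bound (C := max C 0) zero_le_one hsm ht (fun y hy =>
      (hC (y, x) ⟨hy, by simpa using hx⟩).trans (le_max_left _ _))
    rw [taylor_within_apply, Finset.sum_range_succ, Finset.sum_eq_zero] at hb
    · refine le_trans (le_of_eq ?_) (hb.trans ?_)
      · congr 2
        rw [zero_add, sub_zero, Complex.real_smul]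
        push_cast
        ring
      · rw [sub_zero]
        refine div_le_self ?_ (by exact_mod_cast n.factorial_pos)
        exact mul_nonneg (le_max_right _ _) (pow_nonneg ht.1 _)
    · intro k hk
      rw [hvan' x k (Finset.mem_range.1 hk), smul_zero]

end Taylor

section Extension

variable {n : ℕ}

open Classical in
/-- Extension of a function on convex bodies to all sets, by `0` outside convex bodies. -/
def extendZero (φ : ConvexBody (Euc n) → ℂ) (s : Set (Euc n)) : ℂ :=
  if h : Convex ℝ s ∧ IsCompact s ∧ s.Nonempty then φ ⟨s, h.1, h.2.1, h.2.2⟩ else 0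

theorem extendZero_coe (φ : ConvexBody (Euc n) → ℂ) (K : ConvexBody (Euc n)) :
    extendZero φ (K : Set (Euc n)) = φ K :=
  dif_pos ⟨K.convex, K.isCompact, K.nonempty⟩

theorem extendZero_empty (φ : ConvexBody (Euc n) → ℂ) : extendZero φ ∅ = 0 :=
  dif_neg fun h => Set.not_nonempty_empty h.2.2

theorem continuous_coord (j : Fin n) : Continuous fun x : Euc n => x j := by fun_prop

theorem isLinearMap_coord (j : Fin n) : IsLinearMap ℝ fun x : Euc n => x j :=
  ⟨fun _ _ => rfl, fun _ _ => rfl⟩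

theorem extendZero_split {φ : ConvexBody (Euc n) → ℂ} (hval : IsValuation φ) {s : Set (Euc n)}
    (hs : Convex ℝ s) (hc : IsCompact s) (j : Fin n) (a : ℝ)
    (h0 : extendZero φ (s ∩ {x | x j = a}) = 0) :
    extendZero φ s = extendZero φ (s ∩ {x | x j ≤ a}) + extendZero φ (s ∩ {x | a ≤ x j}) := by
  have hA : Convex ℝ (s ∩ {x | x j ≤ a}) := hs.inter (convex_halfSpace_le (isLinearMap_coord j) a)
  have hB : Convex ℝ (s ∩ {x | a ≤ x j}) := hs.inter (convex_halfSpace_ge (isLinearMap_coord j) a)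
  have hAc : IsCompact (s ∩ {x | x j ≤ a}) :=
    hc.inter_right (isClosed_le (continuous_coord j) continuous_const)
  have hBc : IsCompact (s ∩ {x | a ≤ x j}) :=
    hc.inter_right (isClosed_le continuous_const (continuous_coord j))
  by_cases hAn : (s ∩ {x | x j ≤ a}).Nonempty
  · by_cases hBn : (s ∩ {x | a ≤ x j}).Nonempty
    · have hNn : (s ∩ {x | x j = a}).Nonempty := by
        obtain ⟨x, hx, hxa⟩ := hAn
        obtain ⟨y, hy, hya⟩ := hBn
        obtain ⟨z, hz, hza⟩ := hs.isPreconnected.intermediate_value hx hy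
          (continuous_coord j).continuousOn ⟨hxa, hya⟩
        exact ⟨z, hz, hza⟩
      have hNc : Convex ℝ (s ∩ {x | x j = a}) :=
        hs.inter (convex_hyperplane (isLinearMap_coord j) a)
      have hNk : IsCompact (s ∩ {x | x j = a}) :=
        hc.inter_right (isClosed_eq (continuous_coord j) continuous_const)
      have key := hval ⟨_, hA, hAc, hAn⟩ ⟨_, hB, hBc, hBn⟩ ⟨s, hs, hc, hAn.mono inter_subset_left⟩
        ⟨_, hNc, hNk, hNn⟩
        (by
          ext x
          simp only [ConvexBody.coe_mk, mem_union, mem_inter_iff, mem_ofPred_eq]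
          have := le_total (x j) a
          tauto)
        (by
          ext x
          simp only [ConvexBody.coe_mk, mem_inter_iff, mem_ofPred_eq, le_antisymm_iff]
          tauto)
      rw [← extendZero_coe φ, ← extendZero_coe φ, ← extendZero_coe φ, ← extendZero_coe φ] at key
      simp only [ConvexBody.coe_mk] at key
      rwa [h0, add_zero] at key
    · rw [not_nonempty_iff_eq_empty] at hBn
      rw [hBn, extendZero_empty, add_zero]
      congr 1
      ext x
      refine ⟨fun hx => ⟨hx, ?_⟩, fun hx => hx.1⟩
      by_contra hlt
      rw [mem_ofPred_eq, not_le] at hlt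
      have hmem : x ∈ s ∩ {x | a ≤ x j} := ⟨hx, hlt.le⟩
      rwa [hBn] at hmem
  · rw [not_nonempty_iff_eq_empty] at hAn
    rw [hAn, extendZero_empty, zero_add]
    congr 1
    ext x
    refine ⟨fun hx => ⟨hx, ?_⟩, fun hx => hx.1⟩
    by_contra hlt
    rw [mem_ofPred_eq, not_le] at hlt
    have hmem : x ∈ s ∩ {x | x j ≤ a} := ⟨hx, hlt.le⟩
    rwa [hAn] at hmem

theorem convex_slab (j : Fin n) (a b : ℝ) : Convex ℝ {x : Euc n | a ≤ x j ∧ x j ≤ b} :=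
  (convex_halfSpace_ge (isLinearMap_coord j) a).inter
    (convex_halfSpace_le (isLinearMap_coord j) b)

theorem isClosed_slab (j : Fin n) (a b : ℝ) : IsClosed {x : Euc n | a ≤ x j ∧ x j ≤ b} :=
  (isClosed_le continuous_const (continuous_coord j)).inter
    (isClosed_le (continuous_coord j) continuous_const)

theorem extendZero_slabs {φ : ConvexBody (Euc n) → ℂ} (hval : IsValuation φ) {s : Set (Euc n)}
    (hs : Convex ℝ s) (hc : IsCompact s) (j : Fin n)
    (h0 : ∀ b : ℝ, extendZero φ (s ∩ {x | x j = b}) = 0) {a : ℤ → ℝ} (ha : Monotone a)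
    {p q : ℤ} (hpq : p ≤ q) :
    extendZero φ (s ∩ {x | a p ≤ x j ∧ x j ≤ a q}) =
      ∑ m ∈ Finset.Ico p q, extendZero φ (s ∩ {x | a m ≤ x j ∧ x j ≤ a (m + 1)}) := by
  induction q, hpq using Int.leInduction with
  | base =>
    rw [Finset.Ico_self, Finset.sum_empty, ← h0 (a p)]
    congr 2
    ext x
    simp only [mem_ofPred_eq]
    exact ⟨fun h => le_antisymm h.2 h.1, fun h => ⟨h.ge, h.le⟩⟩
  | succ q hpq ih =>
    have hq : a q ≤ a (q + 1) := ha (by lia)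
    have hp : a p ≤ a q := ha hpq
    have hset : Finset.Ico p (q + 1) = insert q (Finset.Ico p q) := by
      ext m
      simp only [Finset.mem_insert, Finset.mem_Ico]
      lia
    rw [hset, Finset.sum_insert (by simp), ← ih,
      extendZero_split hval (hs.inter (convex_slab j (a p) (a (q + 1))))
        (hc.inter_right (isClosed_slab j _ _)) j (a q), add_comm]
    · congr 2
      · ext x
        simp only [mem_inter_iff, mem_ofPred_eq]
        refine ⟨fun h => ⟨h.1.1, h.2, h.1.2.2⟩, fun h => ⟨⟨h.1, hp.trans h.2.1, h.2.2⟩, h.2.1⟩⟩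
      · ext x
        simp only [mem_inter_iff, mem_ofPred_eq]
        refine ⟨fun h => ⟨h.1.1, h.1.2.1, h.2⟩, fun h => ⟨⟨h.1, h.2.1, h.2.2.trans hq⟩, h.2.2⟩⟩
    · rw [← h0 (a q)]
      congr 1
      ext x
      simp only [mem_inter_iff, mem_ofPred_eq]
      refine ⟨fun h => ⟨h.1.1, h.2⟩, fun h => ⟨⟨h.1, ?_, ?_⟩, h.2⟩⟩
      · rw [h.2]; exact hp
      · rw [h.2]; exact hq

/-- Multi-indices with entries in `[p, q)` on `T` and `0` off `T`. -/
def gridIndex (T : Finset (Fin n)) (p q : ℤ) : Finset (Fin n → ℤ) :=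
  Fintype.piFinset fun j => if j ∈ T then Finset.Ico p q else {0}

theorem mem_gridIndex {T : Finset (Fin n)} {p q : ℤ} {z : Fin n → ℤ} :
    z ∈ gridIndex T p q ↔ (∀ j ∈ T, p ≤ z j ∧ z j < q) ∧ ∀ j ∉ T, z j = 0 := by
  simp only [gridIndex, Fintype.mem_piFinset]
  constructor
  · intro h
    refine ⟨fun j hj => ?_, fun j hj => ?_⟩
    · simpa [hj] using h j
    · simpa [hj] using h j
  · intro h j
    by_cases hj : j ∈ T
    · simpa [hj] using h.1 j hj
    · simpa [hj] using h.2 j hj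

theorem card_gridIndex (T : Finset (Fin n)) {p q : ℤ} :
    (gridIndex T p q).card = (q - p).toNat ^ T.card := by
  rw [gridIndex, Fintype.card_piFinset]
  have : ∀ j, (if j ∈ T then Finset.Ico p q else {0}).card =
      if j ∈ T then (q - p).toNat else 1 := by
    intro j
    split_ifs <;> simp
  simp_rw [this]
  rw [Finset.prod_ite_mem, Finset.univ_inter, Finset.prod_const]

theorem extendZero_grid {φ : ConvexBody (Euc n) → ℂ} (hval : IsValuation φ) {s : Set (Euc n)}
    (hs : Convex ℝ s) (hc : IsCompact s) (T : Finset (Fin n))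
    (h0 : ∀ s' ⊆ s, Convex ℝ s' → IsCompact s' → ∀ j ∈ T, ∀ b : ℝ,
      extendZero φ (s' ∩ {x | x j = b}) = 0)
    {a : Fin n → ℤ → ℝ} (ha : ∀ j, Monotone (a j)) {p q : ℤ} (hpq : p ≤ q)
    (hsub : ∀ x ∈ s, ∀ j ∈ T, a j p ≤ x j ∧ x j ≤ a j q) :
    extendZero φ s = ∑ z ∈ gridIndex T p q,
      extendZero φ (s ∩ {x | ∀ j ∈ T, a j (z j) ≤ x j ∧ x j ≤ a j (z j + 1)}) := by
  induction T using Finset.induction_on with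
  | empty =>
    have : gridIndex (∅ : Finset (Fin n)) p q = {fun _ => 0} := by
      ext z
      simp only [mem_gridIndex, Finset.mem_singleton, funext_iff]
      simp
    rw [this, Finset.sum_singleton]
    simp
  | insert i T hi ih =>
    rw [ih (fun s' h1 h2 h3 j hj => h0 s' h1 h2 h3 j (Finset.mem_insert_of_mem hj))
      (fun x hx j hj => hsub x hx j (Finset.mem_insert_of_mem hj))]
    have step : ∀ z ∈ gridIndex T p q,
        extendZero φ (s ∩ {x | ∀ j ∈ T, a j (z j) ≤ x j ∧ x j ≤ a j (z j + 1)}) =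
        ∑ m ∈ Finset.Ico p q, extendZero φ
          ((s ∩ {x | ∀ j ∈ T, a j (z j) ≤ x j ∧ x j ≤ a j (z j + 1)}) ∩
            {x | a i m ≤ x i ∧ x i ≤ a i (m + 1)}) := by
      intro z _
      have hset : {x : Euc n | ∀ j ∈ T, a j (z j) ≤ x j ∧ x j ≤ a j (z j + 1)} =
          ⋂ j ∈ T, {x : Euc n | a j (z j) ≤ x j ∧ x j ≤ a j (z j + 1)} := by
        ext x; simp
      have hcv : Convex ℝ (s ∩ {x | ∀ j ∈ T, a j (z j) ≤ x j ∧ x j ≤ a j (z j + 1)}) := by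
        rw [hset]
        exact hs.inter (convex_iInter₂ fun j _ => convex_slab j _ _)
      have hcp : IsCompact (s ∩ {x | ∀ j ∈ T, a j (z j) ≤ x j ∧ x j ≤ a j (z j + 1)}) := by
        rw [hset]
        exact hc.inter_right (isClosed_biInter fun j _ => isClosed_slab j _ _)
      rw [← extendZero_slabs hval hcv hcp i
        (fun b => h0 _ inter_subset_left hcv hcp i (Finset.mem_insert_self _ _) b) (ha i) hpq]
      congr 1
      ext x
      refine ⟨fun hx => ⟨hx, hsub x hx.1 i (Finset.mem_insert_self _ _)⟩, fun hx => hx.1⟩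
    rw [Finset.sum_congr rfl step, ← Finset.sum_product']
    refine Finset.sum_bij' (fun zm _ => Function.update zm.1 i zm.2)
      (fun z _ => (Function.update z i 0, z i)) ?_ ?_ ?_ ?_ ?_
    · rintro ⟨z, m⟩ h
      rw [Finset.mem_product, mem_gridIndex, Finset.mem_Ico] at h
      rw [mem_gridIndex]
      refine ⟨fun j hj => ?_, fun j hj => ?_⟩
      · by_cases hji : j = i
        · subst hji; simpa using h.2
        · rw [Function.update_of_ne hji]
          exact h.1.1 j ((Finset.mem_insert.1 hj).resolve_left hji)
      · rw [Finset.mem_insert, not_or] at hj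
        rw [Function.update_of_ne hj.1]
        exact h.1.2 j hj.2
    · intro z h
      rw [mem_gridIndex] at h
      rw [Finset.mem_product, mem_gridIndex, Finset.mem_Ico]
      refine ⟨⟨fun j hj => ?_, fun j hj => ?_⟩, h.1 i (Finset.mem_insert_self _ _)⟩
      · have hji : j ≠ i := fun e => hi (e ▸ hj)
        simpa [Function.update_of_ne hji] using h.1 j (Finset.mem_insert_of_mem hj)
      · by_cases hji : j = i
        · subst hji; simp
        · simpa [Function.update_of_ne hji] using h.2 j (by simp [hji, hj])
    · rintro ⟨z, m⟩ h
      rw [Finset.mem_product, mem_gridIndex] at h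
      have : z i = 0 := h.1.2 i hi
      simp [← this]
    · intro z h
      simp
    · rintro ⟨z, m⟩ h
      congr 1
      ext x
      simp only [mem_inter_iff, mem_ofPred_eq, Finset.forall_mem_insert, Function.update_self]
      have : (∀ j ∈ T, a j (Function.update z i m j) ≤ x j ∧
          x j ≤ a j (Function.update z i m j + 1)) ↔
          ∀ j ∈ T, a j (z j) ≤ x j ∧ x j ≤ a j (z j + 1) := by
        refine forall₂_congr fun j hj => ?_
        rw [Function.update_of_ne (ne_of_mem_of_not_mem hj hi)]
      rw [this]
      tauto

end Extension

section Polytopes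

variable {n : ℕ}

/-- Pairing of an integral covector with a vector. -/
def intPairing (u : Fin n → ℤ) (x : Euc n) : ℝ := ∑ j, (u j : ℝ) * x j

theorem isLinearMap_intPairing (u : Fin n → ℤ) : IsLinearMap ℝ (intPairing u) where
  map_add x y := by simp [intPairing, mul_add, Finset.sum_add_distrib]
  map_smul a x := by
    simp only [intPairing, PiLp.smul_apply, smul_eq_mul, Finset.mul_sum]
    exact Finset.sum_congr rfl fun j _ => by ring

theorem continuous_intPairing (u : Fin n → ℤ) : Continuous (intPairing u) := by
  unfold intPairing; fun_prop

theorem intPairing_single (j : Fin n) (a : ℤ) (x : Euc n) :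
    intPairing (Pi.single j a) x = a * x j := by
  rw [intPairing, Finset.sum_eq_single j]
  · simp
  · intro i _ hi; simp [Pi.single_eq_of_ne hi]
  · simp

/-- A polyhedron with integral facet normals and integral offsets relative to `c`. -/
def latticePoly (c : Euc n) (F : Finset ((Fin n → ℤ) × ℤ)) : Set (Euc n) :=
  {x | ∀ w ∈ F, intPairing w.1 (x - c) ≤ w.2}

/-- The intersection of the unit cube with translated half-spaces normal to the members of `F`. -/
def cubeCell (F : Finset ((Fin n → ℤ) × ℤ)) (κ : (Fin n → ℤ) × ℤ → ℤ) : Set (Euc n) :=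
  {y | (∀ j, 0 ≤ y j ∧ y j ≤ 1) ∧ ∀ w ∈ F, intPairing w.1 y ≤ κ w}

theorem isCompact_box (c : Euc n) (R : ℝ) : IsCompact {x : Euc n | ∀ j, |x j - c j| ≤ R} := by
  have h := (isCompact_univ_pi fun j => isCompact_Icc (a := c j - R) (b := c j + R)).image
    (PiLp.continuous_toLp 2 (fun _ : Fin n => ℝ))
  convert h using 1
  ext x
  simp only [mem_ofPred_eq, mem_image, Set.mem_pi, mem_univ, true_imp_iff, mem_Icc]
  constructor
  · intro hx
    refine ⟨x.ofLp, fun j => ?_, rfl⟩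
    have := abs_le.1 (hx j)
    constructor <;> linarith
  · rintro ⟨y, hy, rfl⟩ j
    have := hy j
    rw [abs_le]
    constructor <;> linarith

theorem convex_latticePoly (c : Euc n) (F : Finset ((Fin n → ℤ) × ℤ)) :
    Convex ℝ (latticePoly c F) := by
  have : latticePoly c F = ⋂ w ∈ F, {x | intPairing w.1 x ≤ w.2 + intPairing w.1 c} := by
    ext x
    simp only [latticePoly, mem_ofPred_eq, mem_iInter, (isLinearMap_intPairing _).map_sub,
      sub_le_iff_le_add]
  rw [this]
  exact convex_iInter₂ fun w _ => convex_halfSpace_le (isLinearMap_intPairing w.1) _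

theorem isClosed_latticePoly (c : Euc n) (F : Finset ((Fin n → ℤ) × ℤ)) :
    IsClosed (latticePoly c F) := by
  have : latticePoly c F = ⋂ w ∈ F, {x | intPairing w.1 (x - c) ≤ w.2} := by
    ext x
    simp only [latticePoly, mem_ofPred_eq, mem_iInter]
  rw [this]
  exact isClosed_biInter fun w _ => isClosed_le
    ((continuous_intPairing w.1).comp (continuous_id.sub continuous_const)) continuous_const

theorem convex_cubeCell (F : Finset ((Fin n → ℤ) × ℤ)) (κ : (Fin n → ℤ) × ℤ → ℤ) :
    Convex ℝ (cubeCell F κ) := by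
  have : cubeCell F κ = (⋂ j, {y : Euc n | 0 ≤ y j ∧ y j ≤ 1}) ∩
      ⋂ w ∈ F, {x | intPairing w.1 x ≤ κ w} := by
    ext x
    simp [cubeCell]
  rw [this]
  exact (convex_iInter fun j => convex_slab j 0 1).inter
    (convex_iInter₂ fun w _ => convex_halfSpace_le (isLinearMap_intPairing w.1) _)

theorem isCompact_cubeCell (F : Finset ((Fin n → ℤ) × ℤ)) (κ : (Fin n → ℤ) × ℤ → ℤ) :
    IsCompact (cubeCell F κ) := by
  have : cubeCell F κ = (⋂ j, {y : Euc n | 0 ≤ y j ∧ y j ≤ 1}) ∩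
      ⋂ w ∈ F, {x | intPairing w.1 x ≤ κ w} := by
    ext x
    simp [cubeCell]
  refine (isCompact_box 0 1).of_isClosed_subset ?_ ?_
  · rw [this]
    exact (isClosed_iInter fun j => isClosed_slab j 0 1).inter
      (isClosed_biInter fun w _ => isClosed_le (continuous_intPairing w.1) continuous_const)
  · intro x hx j
    have := hx.1 j
    simp only [PiLp.zero_apply, sub_zero]
    exact abs_le.2 ⟨by linarith, this.2⟩

theorem finite_cubeCells (F : Finset ((Fin n → ℤ) × ℤ)) : (range (cubeCell F)).Finite := by
  set M : ℤ := ∑ w ∈ F, ∑ j, |w.1 j| with hM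
  have hb : ∀ w ∈ F, ∀ y : Euc n, (∀ j, 0 ≤ y j ∧ y j ≤ 1) → |intPairing w.1 y| ≤ M := by
    intro w hw y hy
    have h1 : |intPairing w.1 y| ≤ ∑ j, |(w.1 j : ℝ)| := by
      refine (Finset.abs_sum_le_sum_abs _ _).trans (Finset.sum_le_sum fun j _ => ?_)
      rw [abs_mul]
      exact mul_le_of_le_one_right (abs_nonneg _) (abs_le.2 ⟨by linarith [(hy j).1], (hy j).2⟩)
    have h2 : ∑ j, |w.1 j| ≤ M :=
      Finset.single_le_sum (f := fun w : (Fin n → ℤ) × ℤ => ∑ j, |w.1 j|)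
        (fun w _ => Finset.sum_nonneg fun j _ => abs_nonneg _) hw
    refine h1.trans ?_
    exact_mod_cast h2
  let g : (F → Icc (-M - 1) M) → Set (Euc n) := fun κ =>
    {y | (∀ j, 0 ≤ y j ∧ y j ≤ 1) ∧ ∀ w : F, intPairing w.1.1 y ≤ ((κ w : ℤ) : ℝ)}
  refine (finite_range g).subset ?_
  have hM0 : 0 ≤ M := Finset.sum_nonneg fun w _ => Finset.sum_nonneg fun j _ => abs_nonneg _
  rintro _ ⟨κ, rfl⟩
  refine ⟨fun w => ⟨max (-M - 1) (min M (κ w)), le_max_left _ _,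
    max_le (by lia) (min_le_left _ _)⟩, ?_⟩
  ext y
  simp only [g, cubeCell, mem_ofPred_eq, Subtype.forall]
  refine and_congr_right fun hy => forall₂_congr fun w hw => ?_
  have hby := abs_le.1 (hb w hw y hy)
  push_cast
  rw [le_max_iff, le_min_iff]
  constructor
  · rintro (h | h)
    · linarith
    · exact h.2
  · intro h
    exact Or.inr ⟨hby.2, h⟩

theorem coe_scaleTrans (t : ℝ) (x : Euc n) (K : ConvexBody (Euc n)) :
    (scaleTrans t x K : Set (Euc n)) = (fun y => x + t • y) '' (K : Set (Euc n)) := by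
  ext y
  simp only [scaleTrans, ptBody, ConvexBody.coe_add, ConvexBody.coe_smul, ConvexBody.coe_mk,
    add_singleton, mem_image, mem_smul_set]
  simp [add_comm]

/-- The grid cell with index `z` and mesh `1 / N` cuts `latticePoly c F` in a small copy of a
`cubeCell`. -/
theorem latticePoly_inter_cell (c : Euc n) (F : Finset ((Fin n → ℤ) × ℤ)) {N : ℕ} (hN : 0 < N)
    (z : Fin n → ℤ) :
    latticePoly c F ∩ {x | ∀ j, c j + z j / N ≤ x j ∧ x j ≤ c j + (z j + 1 : ℤ) / N} =
      (fun y => (c + (N : ℝ)⁻¹ • WithLp.toLp 2 (fun j => (z j : ℝ)) : Euc n) + (N : ℝ)⁻¹ • y) ''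
        cubeCell F (fun w => N * w.2 - ∑ j, w.1 j * z j) := by
  have hN' : (0 : ℝ) < N := by exact_mod_cast hN
  set Z : Euc n := WithLp.toLp 2 (fun j => (z j : ℝ)) with hZ
  have hp : ∀ w : (Fin n → ℤ) × ℤ, ∀ y : Euc n,
      intPairing w.1 ((c + (N : ℝ)⁻¹ • Z + (N : ℝ)⁻¹ • y) - c) ≤ w.2 ↔
      intPairing w.1 y ≤ ((N * w.2 - ∑ j, w.1 j * z j : ℤ) : ℝ) := by
    intro w y
    have h1 : c + (N : ℝ)⁻¹ • Z + (N : ℝ)⁻¹ • y - c = (N : ℝ)⁻¹ • (Z + y) := by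
      rw [smul_add]; abel
    have h2 : intPairing w.1 Z = ((∑ j, w.1 j * z j : ℤ) : ℝ) := by
      simp [intPairing, hZ]
    rw [h1, (isLinearMap_intPairing _).map_smul, (isLinearMap_intPairing _).map_add, h2,
      smul_eq_mul, inv_mul_le_iff₀ hN']
    push_cast
    constructor <;> intro h <;> linarith
  ext x
  constructor
  · rintro ⟨hx, hxz⟩
    have hx' : c + (N : ℝ)⁻¹ • Z + (N : ℝ)⁻¹ • ((N : ℝ) • (x - c) - Z) = x := by
      rw [smul_sub, smul_smul, inv_mul_cancel₀ hN'.ne', one_smul]; abel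
    refine ⟨(N : ℝ) • (x - c) - Z, ⟨fun j => ?_, fun w hw => ?_⟩, hx'⟩
    · have h := hxz j
      have e : ((N : ℝ) • (x - c) - Z) j = N * (x j - c j) - z j := by simp [hZ]
      rw [e]
      push_cast at h
      have h1 : (z j : ℝ) / N ≤ x j - c j := by linarith [h.1]
      have h2 : x j - c j ≤ (z j + 1 : ℝ) / N := by linarith [h.2]
      rw [div_le_iff₀ hN'] at h1
      rw [le_div_iff₀ hN'] at h2
      constructor <;> linarith
    · rw [← hp, hx']
      exact hx w hw
  · rintro ⟨y, ⟨hy, hw⟩, rfl⟩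
    refine ⟨fun w hwF => (hp w y).2 (hw w hwF), fun j => ?_⟩
    have e : (c + (N : ℝ)⁻¹ • Z + (N : ℝ)⁻¹ • y) j = c j + (z j + y j) / N := by
      simp [hZ]; ring
    simp only [e]
    push_cast
    have := hy j
    constructor <;> gcongr <;> linarith

theorem norm_extendZero_cell_le {φ : ConvexBody (Euc n) → ℂ}
    (hsm : ∀ K : ConvexBody (Euc n),
      ContDiffOn ℝ ∞ (fun p : ℝ × Euc n => φ (scaleTrans p.1 p.2 K))
        (Set.Icc 0 1 ×ˢ (Set.univ : Set (Euc n))))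
    (hvan : ∀ (K : ConvexBody (Euc n)) (x : Euc n), ∀ k < n,
      iteratedDerivWithin k (fun t => φ (scaleTrans t x K)) (Set.Ici 0) 0 = 0)
    (F : Finset ((Fin n → ℤ) × ℤ)) (R : ℝ) :
    ∃ C : ℝ, 0 ≤ C ∧ ∀ t ∈ Icc (0 : ℝ) 1, ∀ κ, ∀ x : Euc n, ‖x‖ ≤ R →
      ‖extendZero φ ((fun y => x + t • y) '' cubeCell F κ)‖ ≤ C * t ^ n := by
  have key : ∀ s ∈ range (cubeCell F), ∃ C : ℝ, 0 ≤ C ∧ ∀ t ∈ Icc (0 : ℝ) 1, ∀ x : Euc n, ‖x‖ ≤ R →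
      ‖extendZero φ ((fun y => x + t • y) '' s)‖ ≤ C * t ^ n := by
    rintro _ ⟨κ, rfl⟩
    by_cases hne : (cubeCell F κ).Nonempty
    · set L : ConvexBody (Euc n) := ⟨cubeCell F κ, convex_cubeCell F κ, isCompact_cubeCell F κ, hne⟩
      obtain ⟨f, hf, hbd⟩ := exists_smooth_leading_coeff n (hsm L) (hvan L)
      obtain ⟨C, hC0, hC⟩ := hbd R
      obtain ⟨D, hD⟩ := (isCompact_closedBall (0 : Euc n) R).exists_bound_of_continuousOn
        hf.continuous.continuousOn
      refine ⟨C + max D 0, add_nonneg hC0 (le_max_right _ _), fun t ht x hx => ?_⟩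
      have e : (fun y => x + t • y) '' cubeCell F κ = (scaleTrans t x L : Set (Euc n)) :=
        (coe_scaleTrans t x L).symm
      rw [e, extendZero_coe]
      have h1 := hC x hx t ht
      have h2 : ‖(t : ℂ) ^ n * f x‖ ≤ max D 0 * t ^ n := by
        rw [norm_mul, norm_pow, Complex.norm_real, Real.norm_of_nonneg ht.1, mul_comm]
        have := (hD x (by simpa using hx)).trans (le_max_left D 0)
        have := ht.1
        gcongr
      have h3 : C * t ^ (n + 1) ≤ C * t ^ n := by
        refine mul_le_mul_of_nonneg_left ?_ hC0
        exact pow_le_pow_of_le_one ht.1 ht.2 (Nat.le_succ n)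
      have h4 : ‖φ (scaleTrans t x L)‖ ≤
          ‖φ (scaleTrans t x L) - (t : ℂ) ^ n * f x‖ + ‖(t : ℂ) ^ n * f x‖ := by
        simpa using norm_add_le (φ (scaleTrans t x L) - (t : ℂ) ^ n * f x) ((t : ℂ) ^ n * f x)
      simp only at h1
      linarith
    · rw [not_nonempty_iff_eq_empty] at hne
      refine ⟨0, le_rfl, fun t ht x hx => ?_⟩
      rw [hne, image_empty, extendZero_empty]
      simp
  choose! C hC0 hC using key
  obtain ⟨B, hB⟩ := ((finite_cubeCells F).image C).bddAbove
  refine ⟨max B 0, le_max_right _ _, fun t ht κ x hx => ?_⟩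
  refine (hC _ ⟨κ, rfl⟩ t ht x hx).trans ?_
  have := pow_nonneg ht.1 n
  gcongr
  exact (hB ⟨_, ⟨κ, rfl⟩, rfl⟩).trans (le_max_left _ _)

end Polytopes

section Approximation

variable {n : ℕ}

theorem exists_intPairing_separating (K : ConvexBody (Euc n)) (c : Euc n) {x : Euc n} (hx : x ∉ K) :
    ∃ (u : Fin n → ℤ) (m : ℤ), (∀ k ∈ K, intPairing u (k - c) ≤ m) ∧
      (m : ℝ) < intPairing u (x - c) := by
  obtain ⟨f, r, hK, hr⟩ := geometric_hahn_banach_closed_point K.convex K.isClosed hx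
  obtain ⟨D, hD⟩ := K.isCompact.exists_bound_of_continuousOn
    (f := fun k : Euc n => ∑ j, |x j - k j|) (by fun_prop)
  have hδ : 0 < f x - r := by linarith
  obtain ⟨q, hq⟩ := exists_nat_gt ((D + 1) / (f x - r))
  rw [div_lt_iff₀ hδ] at hq
  set v : Fin n → ℝ := fun j => f (EuclideanSpace.single j 1) with hv
  have hf : ∀ y : Euc n, f y = ∑ j, v j * y j := by
    intro y
    have hy : y = ∑ j, y j • EuclideanSpace.single j (1 : ℝ) := by
      ext i
      simp [Finset.sum_apply, Pi.single_apply]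
    conv_lhs => rw [hy]
    simp [hv, mul_comm]
  have hgap : ∀ k ∈ K, intPairing (fun j => round (q * v j)) (k - c) + 1 ≤
      intPairing (fun j => round (q * v j)) (x - c) := by
    intro k hk
    have h1 : intPairing (fun j => round (q * v j)) (x - c) -
        intPairing (fun j => round (q * v j)) (k - c) =
        q * f (x - k) + ∑ j, ((round (q * v j) : ℝ) - q * v j) * (x j - k j) := by
      rw [hf, intPairing, intPairing, Finset.mul_sum, ← Finset.sum_sub_distrib,
        ← Finset.sum_add_distrib]
      refine Finset.sum_congr rfl fun j _ => ?_
      simp only [PiLp.sub_apply]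
      ring
    have h2 : |∑ j, ((round (q * v j) : ℝ) - q * v j) * (x j - k j)| ≤ D := by
      refine le_trans ?_ ((le_abs_self _).trans (hD k hk))
      refine (Finset.abs_sum_le_sum_abs _ _).trans (Finset.sum_le_sum fun j _ => ?_)
      rw [abs_mul]
      refine mul_le_of_le_one_left (abs_nonneg _) ?_
      rw [abs_sub_comm]
      exact (abs_sub_round _).trans (by norm_num)
    have h3 : (q : ℝ) * (f x - r) ≤ q * f (x - k) := by
      rw [map_sub]
      have := hK k hk
      gcongr
    have := (abs_le.1 h2).1
    linarith
  refine ⟨fun j => round (q * v j), ⌈intPairing (fun j => round (q * v j)) (x - c)⌉ - 1,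
    fun k hk => ?_, ?_⟩
  · have := hgap k hk
    have h2 := Int.le_ceil (intPairing (fun j => round (q * v j)) (x - c))
    push_cast
    linarith
  · have := Int.ceil_lt_add_one (intPairing (fun j => round (q * v j)) (x - c))
    push_cast
    linarith

theorem exists_latticePoly_approx (K : ConvexBody (Euc n)) (S : Finset (Fin n)) (c : Euc n)
    (hS : ∀ x ∈ K, ∀ j ∉ S, x j = c j) (R : ℕ) (hR : ∀ x ∈ K, ∀ j, |x j - c j| ≤ R)
    {ε : ℝ} (hε : 0 < ε) :
    ∃ F : Finset ((Fin n → ℤ) × ℤ), (K : Set (Euc n)) ⊆ latticePoly c F ∧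
      latticePoly c F ⊆ Metric.thickening ε (K : Set (Euc n)) ∧
      (∀ x ∈ latticePoly c F, ∀ j ∉ S, x j = c j) ∧
      ∀ x ∈ latticePoly c F, ∀ j, |x j - c j| ≤ R := by
  classical
  let W := {w : (Fin n → ℤ) × ℤ // ∀ k ∈ K, intPairing w.1 (k - c) ≤ w.2}
  let H : W → Set (Euc n) := fun w => {x | intPairing w.1.1 (x - c) ≤ w.1.2}
  have hC : IsCompact ({x : Euc n | ∀ j, |x j - c j| ≤ R} \ Metric.thickening ε (K : Set (Euc n))) :=
    (isCompact_box c R).diff Metric.isOpen_thickening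
  obtain ⟨u, hu⟩ := hC.elim_finite_subfamily_closed H
    (fun w => isClosed_le ((continuous_intPairing w.1.1).comp (continuous_id.sub continuous_const))
      continuous_const)
    (by
      rw [eq_empty_iff_forall_notMem]
      rintro x ⟨⟨-, hx⟩, hxH⟩
      have hxK : x ∉ K := fun h => hx (Metric.self_subset_thickening hε _ h)
      obtain ⟨v, m, h1, h2⟩ := exists_intPairing_separating K c hxK
      have := mem_iInter.1 hxH ⟨(v, m), h1⟩
      exact absurd this (not_le.2 h2))
  let b : Fin n → ℤ := fun j => if j ∈ S then R else 0
  have hb : ∀ x ∈ K, ∀ j, |x j - c j| ≤ b j := by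
    intro x hx j
    by_cases hj : j ∈ S
    · simpa [b, hj] using hR x hx j
    · simp [b, hj, hS x hx j hj]
  have hbox : ∀ x, x ∈ latticePoly c (u.image Subtype.val ∪
      (Finset.univ.image (fun j => ((Pi.single j 1 : Fin n → ℤ), b j)) ∪
        Finset.univ.image (fun j => ((Pi.single j (-1) : Fin n → ℤ), b j)))) ↔
      (∀ w ∈ u, x ∈ H w) ∧ ∀ j, |x j - c j| ≤ b j := by
    intro x
    simp only [latticePoly, mem_ofPred_eq, Finset.forall_mem_union, Finset.forall_mem_image,
      Finset.mem_univ, true_imp_iff, intPairing_single, H]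
    refine and_congr_right fun _ => ?_
    rw [← forall_and]
    refine forall_congr' fun j => ?_
    rw [abs_le]
    simp only [PiLp.sub_apply]
    push_cast
    constructor <;> rintro ⟨h1, h2⟩ <;> constructor <;> linarith
  have hbR : ∀ j, (b j : ℝ) ≤ R := by
    intro j
    by_cases hj : j ∈ S <;> simp [b, hj]
  refine ⟨_, fun x hx => (hbox x).2 ⟨fun w _ => w.2 x hx, hb x hx⟩, fun x hx => ?_,
    fun x hx j hj => ?_, fun x hx j => (((hbox x).1 hx).2 j).trans (hbR j)⟩
  · obtain ⟨h1, h2⟩ := (hbox x).1 hx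
    by_contra hxt
    have : x ∈ ({x : Euc n | ∀ j, |x j - c j| ≤ R} \ Metric.thickening ε (K : Set (Euc n))) ∩
        ⋂ w ∈ u, H w :=
      ⟨⟨fun j => (h2 j).trans (hbR j), hxt⟩, mem_iInter₂.2 h1⟩
    rw [hu] at this
    exact this
  · have := ((hbox x).1 hx).2 j
    simp only [b, hj, if_false, Int.cast_zero] at this
    exact sub_eq_zero.1 (abs_nonpos_iff.1 this)

/-- Every convex body in a coordinate flat is the limit of lattice polytopes in this flat. -/
theorem exists_tendsto_latticePoly (K : ConvexBody (Euc n)) (S : Finset (Fin n)) (c : Euc n)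
    (hS : ∀ x ∈ K, ∀ j ∉ S, x j = c j) :
    ∃ (R : ℕ) (F : ℕ → Finset ((Fin n → ℤ) × ℤ)) (P : ℕ → ConvexBody (Euc n)),
      (∀ i, (P i : Set (Euc n)) = latticePoly c (F i)) ∧
      (∀ i, ∀ x ∈ latticePoly c (F i), ∀ j ∉ S, x j = c j) ∧
      (∀ i, ∀ x ∈ latticePoly c (F i), ∀ j, |x j - c j| ≤ R) ∧
      (∀ i, (K : Set (Euc n)) ⊆ P i) ∧
      (∀ i, (P i : Set (Euc n)) ⊆ Metric.thickening (1 / ((i : ℝ) + 1)) K) ∧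
      Tendsto P atTop (nhds K) := by
  obtain ⟨B, hB⟩ := K.isCompact.exists_bound_of_continuousOn
    (f := fun x : Euc n => ∑ j, |x j - c j|) (by fun_prop)
  obtain ⟨R, hR⟩ := exists_nat_ge B
  have hKR : ∀ x ∈ K, ∀ j, |x j - c j| ≤ R := by
    intro x hx j
    refine le_trans ?_ (((le_abs_self _).trans (hB x hx)).trans hR)
    exact Finset.single_le_sum (f := fun j => |x j - c j|) (fun j _ => abs_nonneg _)
      (Finset.mem_univ j)
  choose F h1 h2 h3 h4 using fun i : ℕ =>
    exists_latticePoly_approx K S c hS R hKR (Nat.one_div_pos_of_nat (α := ℝ) (n := i))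
  let P : ℕ → ConvexBody (Euc n) := fun i => ⟨latticePoly c (F i), convex_latticePoly c (F i),
    (isCompact_box c R).of_isClosed_subset (isClosed_latticePoly c (F i)) (h4 i),
    K.nonempty.mono (h1 i)⟩
  refine ⟨R, F, P, fun i => rfl, h3, h4, h1, h2, ?_⟩
  rw [tendsto_iff_dist_tendsto_zero]
  refine squeeze_zero (fun i => dist_nonneg) (fun i => ?_)
    (tendsto_one_div_add_atTop_nhds_zero_nat (𝕜 := ℝ))
  rw [← ConvexBody.hausdorffDist_coe]
  refine Metric.hausdorffDist_le_of_mem_dist (Nat.one_div_pos_of_nat (α := ℝ)).le (fun x hx => ?_)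
    (fun x hx => ⟨x, h1 i hx, by
      rw [dist_self]; exact Nat.one_div_pos_of_nat.le⟩)
  obtain ⟨y, hy, hxy⟩ := Metric.mem_thickening_iff.1 (h2 i hx)
  exact ⟨y, hy, hxy.le⟩

end Approximation

section Density

variable {n : ℕ}

theorem norm_le_of_abs_coord_le {v : Euc n} {a : ℝ} (ha : 0 ≤ a) (h : ∀ j, |v j| ≤ a) :
    ‖v‖ ≤ n * a := by
  rw [EuclideanSpace.norm_eq, Real.sqrt_le_iff]
  refine ⟨by positivity, ?_⟩
  have h1 : ∑ j, ‖v j‖ ^ 2 ≤ ∑ _j : Fin n, a ^ 2 := by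
    refine Finset.sum_le_sum fun j _ => ?_
    rw [Real.norm_eq_abs]
    exact pow_le_pow_left₀ (abs_nonneg _) (h j) 2
  have h2 : (n : ℝ) ≤ n ^ 2 := by exact_mod_cast Nat.le_self_pow two_ne_zero n
  simp only [Finset.sum_const, Finset.card_univ, Fintype.card_fin, nsmul_eq_mul] at h1
  nlinarith [sq_nonneg a]

/-- The closed grid cube with index `z`, mesh `1 / N` and origin `c`. -/
def gridCube (c : Euc n) (N : ℕ) (z : Fin n → ℤ) : Set (Euc n) :=
  {x | ∀ j, c j + z j / N ≤ x j ∧ x j ≤ c j + (z j + 1 : ℤ) / N}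

theorem norm_gridCorner_le (c : Euc n) (R : ℕ) {S : Finset (Fin n)} {N : ℕ} (hN : 0 < N)
    {z : Fin n → ℤ} (hz : z ∈ gridIndex S (-(R * N)) (R * N)) :
    ‖c + (N : ℝ)⁻¹ • WithLp.toLp 2 (fun j => (z j : ℝ))‖ ≤ ‖c‖ + n * R := by
  have hN' : (0 : ℝ) < N := by exact_mod_cast hN
  refine (norm_add_le _ _).trans (add_le_add_right (norm_le_of_abs_coord_le (by positivity) ?_) _)
  intro j
  rw [mem_gridIndex] at hz
  have hzj : |(z j : ℝ)| ≤ R * N := by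
    by_cases hj : j ∈ S
    · have := hz.1 j hj
      exact_mod_cast abs_le.2 ⟨this.1, this.2.le⟩
    · rw [hz.2 j hj]
      simp only [Int.cast_zero, abs_zero]
      positivity
  simp only [PiLp.smul_apply, smul_eq_mul]
  rw [abs_mul, abs_inv, abs_of_pos hN', inv_mul_le_iff₀ hN', mul_comm]
  exact hzj

theorem extendZero_latticePoly_eq_sum {φ : ConvexBody (Euc n) → ℂ} (hval : IsValuation φ)
    (S : Finset (Fin n)) (c : Euc n) (F : Finset ((Fin n → ℤ) × ℤ)) (R : ℕ)
    (hS : ∀ x ∈ latticePoly c F, ∀ j ∉ S, x j = c j)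
    (hR : ∀ x ∈ latticePoly c F, ∀ j, |x j - c j| ≤ R)
    (h0 : ∀ s' ⊆ latticePoly c F, Convex ℝ s' → IsCompact s' → ∀ j ∈ S, ∀ b : ℝ,
      extendZero φ (s' ∩ {x | x j = b}) = 0) {N : ℕ} (hN : 0 < N) :
    extendZero φ (latticePoly c F) = ∑ z ∈ gridIndex S (-(R * N)) (R * N),
      extendZero φ (latticePoly c F ∩ gridCube c N z) := by
  have hN' : (0 : ℝ) < N := by exact_mod_cast hN
  have hcpt : IsCompact (latticePoly c F) :=
    (isCompact_box c R).of_isClosed_subset (isClosed_latticePoly c F) hR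
  rw [extendZero_grid hval (convex_latticePoly c F) hcpt S h0
    (a := fun j m => c j + (m : ℝ) / N) (p := -(R * N)) (q := R * N) ?_ ?_ ?_]
  · refine Finset.sum_congr rfl fun z hz => ?_
    rw [mem_gridIndex] at hz
    congr 1
    ext x
    refine and_congr_right fun hx => ⟨fun h j => ?_, fun h j _ => h j⟩
    by_cases hj : j ∈ S
    · exact h j hj
    · rw [hS x hx j hj, hz.2 j hj]
      constructor
      · simp
      · simp
  · intro j m m' hm
    have : (m : ℝ) ≤ m' := by exact_mod_cast hm
    simp only
    gcongr
  · have : (0 : ℤ) ≤ R * N := by positivity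
    linarith
  · intro x hx j _
    have := abs_le.1 (hR x hx j)
    push_cast
    rw [neg_div, mul_div_cancel_right₀ _ hN'.ne']
    constructor <;> linarith

theorem extendZero_eq_zero_of_flat {φ : ConvexBody (Euc n) → ℂ} (hval : IsValuation φ)
    (hcont : Continuous φ)
    (hsm : ∀ K : ConvexBody (Euc n),
      ContDiffOn ℝ ∞ (fun p : ℝ × Euc n => φ (scaleTrans p.1 p.2 K))
        (Set.Icc 0 1 ×ˢ (Set.univ : Set (Euc n))))
    (hvan : ∀ (K : ConvexBody (Euc n)) (x : Euc n), ∀ k < n,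
      iteratedDerivWithin k (fun t => φ (scaleTrans t x K)) (Set.Ici 0) 0 = 0)
    (S : Finset (Fin n)) (hSn : S.card < n) (c : Euc n) {s : Set (Euc n)} (hs : Convex ℝ s)
    (hc : IsCompact s) (hflat : ∀ x ∈ s, ∀ j ∉ S, x j = c j) : extendZero φ s = 0 := by
  induction S using Finset.strongInduction generalizing c s with
  | H S ih =>
  rcases s.eq_empty_or_nonempty with rfl | hne
  · exact extendZero_empty φ
  obtain ⟨R, F, P, hP, hPS, hPR, -, -, hlim⟩ := exists_tendsto_latticePoly ⟨s, hs, hc, hne⟩ S c hflat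
  suffices hz : ∀ i, φ (P i) = 0 by
    have h1 := (hcont.tendsto _).comp hlim
    have h2 : φ ∘ P = fun _ => 0 := funext hz
    rw [h2] at h1
    have h3 := tendsto_nhds_unique h1 tendsto_const_nhds
    rwa [← extendZero_coe φ] at h3
  intro i
  rw [← extendZero_coe φ, hP]
  have h0 : ∀ s' ⊆ latticePoly c (F i), Convex ℝ s' → IsCompact s' → ∀ j ∈ S, ∀ b : ℝ,
      extendZero φ (s' ∩ {x | x j = b}) = 0 := by
    intro s' hs' hcv hcp j hj b
    refine ih (S.erase j) (Finset.erase_ssubset hj) ((Finset.card_erase_le).trans_lt hSn)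
      (WithLp.toLp 2 (Function.update c.ofLp j b))
      (hcv.inter (convex_hyperplane (isLinearMap_coord j) b))
      (hcp.inter_right (isClosed_eq (continuous_coord j) continuous_const)) ?_
    rintro x ⟨hx, hxb⟩ k hk
    by_cases hkj : k = j
    · subst hkj
      simpa using hxb
    · simp only [Function.update_of_ne hkj]
      refine hPS i x (hs' hx) k fun hkS => hk (Finset.mem_erase.2 ⟨hkj, hkS⟩)
  obtain ⟨C, hC0, hC⟩ := norm_extendZero_cell_le hsm hvan (F i) (‖c‖ + n * R)
  have hbound : ∀ N : ℕ, 0 < N → ‖extendZero φ (latticePoly c (F i))‖ ≤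
      ((2 * R : ℝ) ^ S.card * C) * (1 / (N : ℝ)) := by
    intro N hN
    have hN' : (1 : ℝ) ≤ N := by exact_mod_cast hN
    have hN0 : (0 : ℝ) < N := by linarith
    rw [extendZero_latticePoly_eq_sum hval S c (F i) R (hPS i) (hPR i) h0 hN]
    refine (norm_sum_le_of_le (n := fun _ => C * ((N : ℝ)⁻¹) ^ n) _ fun z hz => ?_).trans ?_
    · rw [gridCube, latticePoly_inter_cell c (F i) hN z]
      exact hC _ ⟨by positivity, inv_le_one_of_one_le₀ hN'⟩ _ _ (norm_gridCorner_le c R hN hz)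
    · rw [Finset.sum_const, card_gridIndex, nsmul_eq_mul]
      have e : ((((R * N : ℤ) - -(R * N)).toNat ^ S.card : ℕ) : ℝ) = (2 * R * N : ℝ) ^ S.card := by
        have : ((R * N : ℤ) - -(R * N)).toNat = 2 * R * N := by
          have : ((R * N : ℤ) - -(R * N)) = ((2 * R * N : ℕ) : ℤ) := by push_cast; ring
          rw [this, Int.toNat_natCast]
        rw [this]; push_cast; ring
      rw [e, mul_pow]
      have h1 : ((N : ℝ)⁻¹) ^ n ≤ ((N : ℝ)⁻¹) ^ (S.card + 1) :=
        pow_le_pow_of_le_one (by positivity) (inv_le_one_of_one_le₀ hN') hSn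
      calc (2 * R : ℝ) ^ S.card * (N : ℝ) ^ S.card * (C * ((N : ℝ)⁻¹) ^ n)
          ≤ (2 * R : ℝ) ^ S.card * (N : ℝ) ^ S.card * (C * ((N : ℝ)⁻¹) ^ (S.card + 1)) := by
            gcongr
        _ = ((2 * R : ℝ) ^ S.card * C) * (1 / (N : ℝ)) := by
            rw [pow_succ, inv_pow]
            field_simp
  have hlim0 : Tendsto (fun N : ℕ => ((2 * R : ℝ) ^ S.card * C) * (1 / (N : ℝ))) atTop (nhds 0) := by
    simpa using (tendsto_one_div_atTop_nhds_zero_nat (𝕜 := ℝ)).const_mul ((2 * R : ℝ) ^ S.card * C)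
  have := ge_of_tendsto hlim0 ((eventually_gt_atTop 0).mono hbound)
  exact norm_le_zero_iff.1 this

theorem volume_floor_eq {N : ℕ} (hN : 0 < N) (z : Fin n → ℤ) :
    MeasurableSet {x : Euc n | (fun j => ⌊(N : ℝ) * x j⌋) = z} ∧
      volume {x : Euc n | (fun j => ⌊(N : ℝ) * x j⌋) = z} = ENNReal.ofReal (((N : ℝ)⁻¹) ^ n) := by
  have hN' : (0 : ℝ) < N := by exact_mod_cast hN
  have e : {x : Euc n | (fun j => ⌊(N : ℝ) * x j⌋) = z} = WithLp.ofLp ⁻¹'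
      (univ.pi fun j => Ico ((z j : ℝ) / N) ((z j + 1) / N)) := by
    ext x
    simp only [mem_ofPred_eq, mem_preimage, Set.mem_pi, mem_univ, true_imp_iff, mem_Ico, funext_iff,
      Int.floor_eq_iff, div_le_iff₀ hN', lt_div_iff₀ hN', mul_comm (N : ℝ)]
  have hm : MeasurableSet (univ.pi fun j => Ico ((z j : ℝ) / N) ((z j + 1) / N)) :=
    MeasurableSet.univ_pi fun j => measurableSet_Ico
  rw [e]
  refine ⟨(PiLp.volume_preserving_ofLp (Fin n)).measurable hm, ?_⟩
  rw [(PiLp.volume_preserving_ofLp (Fin n)).measure_preimage hm.nullMeasurableSet, Real.volume_pi_Ico]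
  have : ∀ j, ((z j : ℝ) + 1) / N - z j / N = (N : ℝ)⁻¹ := fun j => by field_simp; ring
  simp only [this, Finset.prod_const, Finset.card_univ, Fintype.card_fin]
  rw [ENNReal.ofReal_pow (by positivity)]

theorem abs_sub_le_of_mem_gridCube {N : ℕ} (hN : 0 < N) {x y : Euc n}
    (hy : y ∈ gridCube 0 N fun j => ⌊(N : ℝ) * x j⌋) (j : Fin n) : |y j - x j| ≤ (N : ℝ)⁻¹ := by
  have hN' : (0 : ℝ) < N := by exact_mod_cast hN
  have h1 := hy j
  have h2 := Int.floor_le ((N : ℝ) * x j)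
  have h3 := Int.lt_floor_add_one ((N : ℝ) * x j)
  push_cast at h1
  simp only [PiLp.zero_apply, zero_add, div_le_iff₀ hN', le_div_iff₀ hN'] at h1
  rw [← mul_le_mul_iff_left₀ hN', inv_mul_cancel₀ hN'.ne', ← abs_of_pos hN', ← abs_mul,
    sub_mul, abs_le]
  constructor <;> linarith

theorem gridCube_floor_subset {x : Euc n} {U : Set (Euc n)} (hU : U ∈ nhds x) :
    ∀ᶠ N : ℕ in atTop, gridCube 0 N (fun j => ⌊(N : ℝ) * x j⌋) ⊆ U := by
  obtain ⟨δ, hδ, hball⟩ := Metric.mem_nhds_iff.1 hU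
  have hlim : Tendsto (fun N : ℕ => (n : ℝ) * (N : ℝ)⁻¹) atTop (nhds 0) := by
    simpa using (tendsto_inv_atTop_nhds_zero_nat (𝕜 := ℝ)).const_mul (n : ℝ)
  filter_upwards [hlim.eventually (gt_mem_nhds hδ), eventually_gt_atTop 0] with N hNδ hN y hy
  refine hball ?_
  rw [Metric.mem_ball, dist_eq_norm]
  exact (norm_le_of_abs_coord_le (by positivity) (abs_sub_le_of_mem_gridCube hN hy)).trans_lt hNδ

theorem gridCorner_mem_gridCube (N : ℕ) (z : Fin n → ℤ) :
    (N : ℝ)⁻¹ • WithLp.toLp 2 (fun j => (z j : ℝ)) ∈ gridCube (0 : Euc n) N z := by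
  intro j
  simp only [PiLp.zero_apply, zero_add, PiLp.smul_apply, smul_eq_mul, Int.cast_add, Int.cast_one,
    div_eq_inv_mul]
  exact ⟨le_rfl, by gcongr; linarith⟩

/-- The unit cube as a convex body. -/
def unitCube (n : ℕ) : ConvexBody (Euc n) :=
  ⟨cubeCell ∅ 0, convex_cubeCell ∅ 0, isCompact_cubeCell ∅ 0, 0, by simp [cubeCell]⟩

theorem gridCube_eq_scaleTrans {N : ℕ} (hN : 0 < N) (z : Fin n → ℤ) :
    gridCube (0 : Euc n) N z = (scaleTrans (N : ℝ)⁻¹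
      ((N : ℝ)⁻¹ • WithLp.toLp 2 (fun j => (z j : ℝ))) (unitCube n) : Set (Euc n)) := by
  have h := latticePoly_inter_cell (0 : Euc n) ∅ hN z
  have h1 : latticePoly (0 : Euc n) ∅ = univ := by ext; simp [latticePoly]
  rw [h1, univ_inter, zero_add] at h
  rw [coe_scaleTrans, gridCube, h]
  have : ∀ κ κ' : (Fin n → ℤ) × ℤ → ℤ, cubeCell (∅ : Finset ((Fin n → ℤ) × ℤ)) κ = cubeCell ∅ κ' := by
    intro κ κ'; simp [cubeCell]
  rw [this _ 0]
  rfl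

theorem extendZero_latticePoly_eq_integral {φ : ConvexBody (Euc n) → ℂ} (hval : IsValuation φ)
    (hcont : Continuous φ)
    (hsm : ∀ K : ConvexBody (Euc n),
      ContDiffOn ℝ ∞ (fun p : ℝ × Euc n => φ (scaleTrans p.1 p.2 K))
        (Set.Icc 0 1 ×ˢ (Set.univ : Set (Euc n))))
    (hvan : ∀ (K : ConvexBody (Euc n)) (x : Euc n), ∀ k < n,
      iteratedDerivWithin k (fun t => φ (scaleTrans t x K)) (Set.Ici 0) 0 = 0)
    {f : Euc n → ℂ} (hf : Continuous f)
    (hfb : ∀ R : ℝ, ∃ C : ℝ, 0 ≤ C ∧ ∀ x : Euc n, ‖x‖ ≤ R → ∀ t ∈ Icc (0 : ℝ) 1,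
      ‖φ (scaleTrans t x (unitCube n)) - (t : ℂ) ^ n * f x‖ ≤ C * t ^ (n + 1))
    (F : Finset ((Fin n → ℤ) × ℤ)) (R : ℕ)
    (hR : ∀ x ∈ latticePoly (0 : Euc n) F, ∀ j, |x j - (0 : Euc n) j| ≤ R) :
    extendZero φ (latticePoly 0 F) = ∫ x in latticePoly 0 F, f x := by
  set P : Set (Euc n) := latticePoly 0 F with hP
  have h0 : ∀ s' ⊆ P, Convex ℝ s' → IsCompact s' → ∀ j ∈ (Finset.univ : Finset (Fin n)), ∀ b : ℝ,
      extendZero φ (s' ∩ {x | x j = b}) = 0 := by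
    intro s' _ hcv hcp j _ b
    refine extendZero_eq_zero_of_flat hval hcont hsm hvan (Finset.univ.erase j) ?_
      (WithLp.toLp 2 fun _ => b)
      (hcv.inter (convex_hyperplane (isLinearMap_coord j) b))
      (hcp.inter_right (isClosed_eq (continuous_coord j) continuous_const)) ?_
    · simpa using Finset.card_erase_lt_of_mem (Finset.mem_univ j)
    · rintro x ⟨-, hxb⟩ k hk
      have : k = j := by simpa using hk
      rw [this]
      exact hxb
  let I : ℕ → Finset (Fin n → ℤ) := fun N => gridIndex Finset.univ (-(R * N)) (R * N)
  let zf : ℕ → Euc n → Fin n → ℤ := fun N x j => ⌊(N : ℝ) * x j⌋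
  let v : ℕ → (Fin n → ℤ) → ℂ := fun N z => (N : ℂ) ^ n * extendZero φ (P ∩ gridCube 0 N z)
  let g : ℕ → Euc n → ℂ := fun N x =>
    ∑ z ∈ I N, {x : Euc n | zf N x = z}.indicator (fun _ => v N z) x
  have hg : ∀ N x, g N x = if zf N x ∈ I N then v N (zf N x) else 0 := by
    intro N x
    simp only [g, indicator_apply, mem_ofPred_eq]
    exact Finset.sum_ite_eq _ _ _
  have hgm : ∀ N : ℕ, 0 < N → Measurable (g N) := by
    intro N hN
    exact Finset.measurable_sum _ fun z _ => measurable_const.indicator (volume_floor_eq hN z).1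
  have hint : ∀ N : ℕ, 0 < N → ∫ x, g N x = extendZero φ P := by
    intro N hN
    have hN' : (N : ℂ) ≠ 0 := by exact_mod_cast hN.ne'
    rw [extendZero_latticePoly_eq_sum hval Finset.univ 0 F R (by simp) hR h0 hN,
      integral_finsetSum]
    · refine Finset.sum_congr rfl fun z _ => ?_
      rw [integral_indicator (volume_floor_eq hN z).1, setIntegral_const, measureReal_def,
        (volume_floor_eq hN z).2, ENNReal.toReal_ofReal (by positivity), Complex.real_smul]
      simp only [v]
      push_cast
      rw [← mul_assoc, ← mul_pow, inv_mul_cancel₀ hN', one_pow, one_mul]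
    · intro z _
      refine (integrable_indicator_iff (volume_floor_eq hN z).1).2 ?_
      refine integrableOn_const ?_
      rw [(volume_floor_eq hN z).2]
      exact ENNReal.ofReal_ne_top
  obtain ⟨C, hC0, hC⟩ := norm_extendZero_cell_le hsm hvan F (‖(0 : Euc n)‖ + n * R)
  have hbound : ∀ N : ℕ, 0 < N → ∀ x, ‖g N x‖ ≤
      {x : Euc n | ∀ j, |x j - (0 : Euc n) j| ≤ R}.indicator (fun _ => C) x := by
    intro N hN x
    have hN' : (1 : ℝ) ≤ N := by exact_mod_cast hN
    have hN0 : (0 : ℝ) < N := by linarith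
    rw [hg]
    split_ifs with hz
    · rw [indicator_of_mem]
      · simp only [v]
        rw [gridCube, latticePoly_inter_cell 0 F hN, norm_mul, norm_pow, Complex.norm_natCast]
        have h1 := hC (N : ℝ)⁻¹ ⟨by positivity, inv_le_one_of_one_le₀ hN'⟩
          (fun w => N * w.2 - ∑ j, w.1 j * zf N x j) _ (norm_gridCorner_le 0 R hN hz)
        calc _ ≤ (N : ℝ) ^ n * (C * (N : ℝ)⁻¹ ^ n) := by gcongr
          _ = C := by rw [inv_pow]; field_simp
      · intro j
        have h1 := (mem_gridIndex.1 hz).1 j (Finset.mem_univ j)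
        have h2 := Int.floor_le ((N : ℝ) * x j)
        have h3 := Int.floor_lt.1 h1.2
        have h4 : (((-(R * N) : ℤ)) : ℝ) ≤ ⌊(N : ℝ) * x j⌋ := by exact_mod_cast h1.1
        push_cast at h3 h4
        simp only [PiLp.zero_apply, sub_zero]
        rw [abs_le]
        constructor
        · refine le_of_mul_le_mul_left ?_ hN0
          linarith
        · refine le_of_mul_le_mul_left ?_ hN0
          linarith
    · rw [norm_zero]
      exact indicator_nonneg (fun _ _ => hC0) x
  have hcpt : IsCompact P :=
    (isCompact_box 0 R).of_isClosed_subset (isClosed_latticePoly 0 F) hR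
  have hcv : Convex ℝ P := convex_latticePoly 0 F
  have hlim : ∀ᵐ x, Tendsto (fun N => g N x) atTop (nhds (P.indicator f x)) := by
    have hfr : ∀ᵐ x : Euc n, x ∉ frontier P :=
      measure_eq_zero_iff_ae_notMem.1 (hcv.addHaar_frontier volume)
    filter_upwards [hfr] with x hx
    by_cases hxP : x ∈ P
    · have hxi : P ∈ nhds x := by
        by_contra hni
        exact hx ⟨subset_closure hxP, fun h => hni (mem_interior_iff_mem_nhds.1 h)⟩
      rw [indicator_of_mem hxP]
      let xN : ℕ → Euc n := fun N => (N : ℝ)⁻¹ • WithLp.toLp 2 (fun j => (zf N x j : ℝ))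
      have hxN : Tendsto xN atTop (nhds x) := by
        rw [tendsto_def]
        intro U hU
        filter_upwards [gridCube_floor_subset hU] with N hN
        exact hN (gridCorner_mem_gridCube N _)
      obtain ⟨D, hD0, hD⟩ := hfb (‖x‖ + 1)
      have hdiff : Tendsto (fun N => g N x - f (xN N)) atTop (nhds 0) := by
        have hlim0 : Tendsto (fun N : ℕ => D * (N : ℝ)⁻¹) atTop (nhds 0) := by
          simpa using (tendsto_inv_atTop_nhds_zero_nat (𝕜 := ℝ)).const_mul D
        refine squeeze_zero_norm' ?_ hlim0
        filter_upwards [gridCube_floor_subset hxi, eventually_gt_atTop 0,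
          hxN.norm.eventually (gt_mem_nhds (lt_add_one ‖x‖))] with N hsub hN hnorm
        have hN' : (1 : ℝ) ≤ N := by exact_mod_cast hN
        have hN0 : (N : ℂ) ≠ 0 := by exact_mod_cast hN.ne'
        have hz : zf N x ∈ I N := by
          refine mem_gridIndex.2 ⟨fun j _ => ?_, fun j hj => absurd (Finset.mem_univ j) hj⟩
          have hNr : (0 : ℝ) < N := by exact_mod_cast hN
          have h1 := (abs_le.1 (hR _ (hsub (gridCorner_mem_gridCube N (zf N x))) j)).1
          have hmem : (WithLp.toLp 2 fun j => ((zf N x j : ℝ) + 1) / N : Euc n) ∈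
              gridCube 0 N (zf N x) := by
            intro j
            simp only [PiLp.zero_apply, zero_add, Int.cast_add, Int.cast_one]
            exact ⟨by gcongr; linarith, le_rfl⟩
          have h2 := (abs_le.1 (hR _ (hsub hmem) j)).2
          simp only [PiLp.zero_apply, sub_zero, PiLp.smul_apply, smul_eq_mul] at h1 h2
          rw [div_le_iff₀ hNr] at h2
          rw [← div_eq_inv_mul, le_div_iff₀ hNr] at h1
          have h3 : zf N x j + 1 ≤ R * N := by exact_mod_cast h2
          have h4 : -(R * N : ℤ) ≤ zf N x j := by
            rw [neg_mul] at h1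
            exact_mod_cast h1
          exact ⟨h4, by lia⟩
        rw [hg, if_pos hz]
        simp only [v]
        rw [inter_eq_right.2 hsub, gridCube_eq_scaleTrans hN, extendZero_coe]
        have h1 := hD (xN N) hnorm.le (N : ℝ)⁻¹ ⟨by positivity, inv_le_one_of_one_le₀ hN'⟩
        have h2 : (N : ℂ) ^ n * φ (scaleTrans (N : ℝ)⁻¹ (xN N) (unitCube n)) - f (xN N) =
            (N : ℂ) ^ n * (φ (scaleTrans (N : ℝ)⁻¹ (xN N) (unitCube n)) -
              (((N : ℝ)⁻¹ : ℝ) : ℂ) ^ n * f (xN N)) := by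
          push_cast
          rw [mul_sub, ← mul_assoc, ← mul_pow, mul_inv_cancel₀ hN0, one_pow, one_mul]
        change ‖(N : ℂ) ^ n * φ (scaleTrans (N : ℝ)⁻¹ (xN N) (unitCube n)) - f (xN N)‖ ≤ _
        rw [h2, norm_mul, norm_pow, Complex.norm_natCast]
        calc _ ≤ (N : ℝ) ^ n * (D * (N : ℝ)⁻¹ ^ (n + 1)) := by gcongr
          _ = D * (N : ℝ)⁻¹ := by rw [pow_succ, inv_pow]; field_simp
      simpa using hdiff.add ((hf.tendsto x).comp hxN)
    · rw [indicator_of_notMem hxP]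
      refine tendsto_const_nhds.congr' ?_
      filter_upwards [gridCube_floor_subset (hcpt.isClosed.isOpen_compl.mem_nhds hxP)] with N hN
      rw [hg]
      split_ifs
      · have : P ∩ gridCube 0 N (zf N x) = ∅ := by
          rw [eq_empty_iff_forall_notMem]
          rintro y ⟨hy, hyc⟩
          exact hN hyc hy
        simp only [v, this, extendZero_empty, mul_zero]
      · rfl
  have hconv : Tendsto (fun N => ∫ x, g N x) atTop (nhds (∫ x, P.indicator f x)) := by
    have hbox := isCompact_box (0 : Euc n) R
    refine tendsto_integral_filter_of_dominated_convergence
      ({x : Euc n | ∀ j, |x j - (0 : Euc n) j| ≤ R}.indicator (fun _ => C)) ?_ ?_ ?_ hlim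
    · filter_upwards [eventually_gt_atTop 0] with N hN
      exact (hgm N hN).aestronglyMeasurable
    · filter_upwards [eventually_gt_atTop 0] with N hN
      exact Eventually.of_forall (hbound N hN)
    · exact (integrable_indicator_iff hbox.measurableSet).2
        (integrableOn_const hbox.measure_lt_top.ne)
  rw [← integral_indicator hcpt.measurableSet]
  refine tendsto_nhds_unique (tendsto_const_nhds.congr' ?_) hconv
  filter_upwards [eventually_gt_atTop 0] with N hN
  exact (hint N hN).symm

end Density

/-- A continuous valuation `φ` such that `(t,x) ↦ φ(tK+x)` is `C^∞` on `[0,1] × ℝⁿ`,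
whose `t`-derivatives at `t = 0` of order `< n` all vanish, and such that the `n`-th
derivative at `0` depends continuously on `K`, is given by integration of a smooth
density: `φ(K) = ∫_K f`. -/
theorem smooth_valuation_in_Wn_is_density {n : ℕ} (hn : 1 ≤ n)
    (φ : ConvexBody (Euc n) → ℂ) (hval : IsValuation φ) (hcont : Continuous φ)
    (hsm : ∀ K : ConvexBody (Euc n),
      ContDiffOn ℝ ∞ (fun p : ℝ × Euc n => φ (scaleTrans p.1 p.2 K))
        (Set.Icc 0 1 ×ˢ (Set.univ : Set (Euc n))))
    (hvan : ∀ (K : ConvexBody (Euc n)) (x : Euc n), ∀ k < n,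
      iteratedDerivWithin k (fun t => φ (scaleTrans t x K)) (Set.Ici 0) 0 = 0)
    (hcn : ∀ x : Euc n,
      Continuous fun K : ConvexBody (Euc n) =>
        iteratedDerivWithin n (fun t => φ (scaleTrans t x K)) (Set.Ici 0) 0) :
    ∃ f : Euc n → ℂ, ContDiff ℝ ∞ f ∧
      ∀ K : ConvexBody (Euc n), φ K = ∫ x in (K : Set (Euc n)), f x := by
  obtain ⟨f, hf, hfb⟩ := exists_smooth_leading_coeff n (hsm (unitCube n)) (hvan (unitCube n))
  refine ⟨f, hf, fun K => ?_⟩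
  obtain ⟨R, F, P, hP, -, hPR, hKP, hPt, hlim⟩ :=
    exists_tendsto_latticePoly K Finset.univ 0 (by simp)
  have hPf : ∀ i, φ (P i) = ∫ x, (P i : Set (Euc n)).indicator f x := by
    intro i
    rw [integral_indicator (P i).isClosed.measurableSet, ← extendZero_coe φ, hP]
    exact extendZero_latticePoly_eq_integral hval hcont hsm hvan hf.continuous hfb (F i) R (hPR i)
  have hbox := isCompact_box (0 : Euc n) R
  obtain ⟨B, hB⟩ := hbox.exists_bound_of_continuousOn hf.continuous.continuousOn
  have hconv : Tendsto (fun i => ∫ x, (P i : Set (Euc n)).indicator f x) atTop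
      (nhds (∫ x, (K : Set (Euc n)).indicator f x)) := by
    refine tendsto_integral_of_dominated_convergence
      ({x : Euc n | ∀ j, |x j - (0 : Euc n) j| ≤ R}.indicator (fun _ => B)) ?_ ?_ ?_ ?_
    · intro i
      exact (hf.continuous.measurable.indicator (P i).isClosed.measurableSet).aestronglyMeasurable
    · exact (integrable_indicator_iff hbox.measurableSet).2
        (integrableOn_const hbox.measure_lt_top.ne)
    · refine fun i => Eventually.of_forall fun x => ?_
      by_cases hx : x ∈ (P i : Set (Euc n))
      · have hxb : x ∈ {x : Euc n | ∀ j, |x j - (0 : Euc n) j| ≤ R} := hPR i x (hP i ▸ hx)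
        rw [indicator_of_mem hx, indicator_of_mem hxb]
        exact hB x hxb
      · rw [indicator_of_notMem hx, norm_zero]
        exact indicator_nonneg (fun y hy => (norm_nonneg _).trans (hB y hy)) x
    · refine Eventually.of_forall fun x => tendsto_const_nhds.congr' ?_
      by_cases hx : x ∈ (K : Set (Euc n))
      · exact Eventually.of_forall fun i => by
          simp only [indicator_of_mem hx, indicator_of_mem (hKP i hx)]
      · have hpos : 0 < Metric.infDist x (K : Set (Euc n)) :=
          (K.isClosed.notMem_iff_infDist_pos K.nonempty).1 hx
        filter_upwards [(tendsto_one_div_add_atTop_nhds_zero_nat (𝕜 := ℝ)).eventually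
          (gt_mem_nhds hpos)] with i hi
        rw [indicator_of_notMem hx, indicator_of_notMem]
        intro hxi
        obtain ⟨y, hy, hxy⟩ := Metric.mem_thickening_iff.1 (hPt i hxi)
        linarith [Metric.infDist_le_dist_of_mem (x := x) hy]
  rw [← integral_indicator K.isClosed.measurableSet]
  refine tendsto_nhds_unique ((hcont.tendsto K).comp hlim) ?_
  simpa only [Function.comp_def, hPf] using hconv
end
end

section
/- Let n ≥ 1, let r ∈ ℕ ∪ {∞}, let f : ℝⁿ → ℂ be of class C^r, and let K_1, …, K_s be convex bodies in ℝⁿ. Then the function (λ_1, …, λ_s) ↦ ∫_{λ_1 K_1 + ⋯ + λ_s K_s} f(x) dx (Lebesgue integral over the Minkowski combination) is of class C^r on the closed orthant ℝ_{≥0}^s: all partial derivatives of order ≤ r exist (one-sided at the boundary) and are continuous on ℝ_{≥0}^s. -/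
open scoped Pointwise ContDiff
open MeasureTheory Set Filter

noncomputable section

/-- A continuous function of `T x p`, with `T` bounded, is bounded uniformly in `x`, locally
uniformly in `p`. -/
theorem Continuous.exists_norm_comp_clm_le {X P E F : Type*}
    [NormedAddCommGroup P] [NormedSpace ℝ P] [NormedAddCommGroup E] [NormedSpace ℝ E]
    [FiniteDimensional ℝ E] [NormedAddCommGroup F] {T : X → P →L[ℝ] E} {M : ℝ}
    (hM : ∀ x, ‖T x‖ ≤ M) {f : E → F} (hf : Continuous f) (p₀ : P) :
    ∃ C, ∀ p ∈ Metric.ball p₀ 1, ∀ x, ‖f (T x p)‖ ≤ C := by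
  have := FiniteDimensional.proper_real E
  obtain ⟨C, hC⟩ := (isCompact_closedBall (0 : E) (M * (‖p₀‖ + 1))).exists_bound_of_continuousOn
    hf.continuousOn
  refine ⟨C, fun p hp x => hC _ ?_⟩
  rw [mem_closedBall_zero_iff]
  have hp' : ‖p‖ ≤ ‖p₀‖ + 1 := by
    have := norm_le_norm_add_norm_sub' p p₀
    rw [mem_ball_iff_norm] at hp
    linarith
  exact ((T x).le_opNorm p).trans
    (mul_le_mul (hM x) hp' (norm_nonneg _) ((norm_nonneg _).trans (hM x)))

set_option maxSynthPendingDepth 3 in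
theorem contDiff_integral_clm_apply_comp.{u} {X : Type*} {P E : Type u} [MeasurableSpace X]
    {μ : Measure X} [NormedAddCommGroup P] [NormedSpace ℝ P] [NormedAddCommGroup E]
    [NormedSpace ℝ E] [FiniteDimensional ℝ E]
    {T : X → P →L[ℝ] E} (hT : AEStronglyMeasurable T μ) {M : ℝ} (hM : ∀ x, ‖T x‖ ≤ M) (r : ℕ) :
    ∀ {F G : Type u} [NormedAddCommGroup F] [NormedSpace ℝ F] [NormedAddCommGroup G]
      [NormedSpace ℝ G] {f : E → F} (_ : ContDiff ℝ r f) {L : X → F →L[ℝ] G}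
      (_ : Integrable L μ), ContDiff ℝ r fun p => ∫ x, L x (f (T x p)) ∂μ := by
  have hTp (p : P) : AEStronglyMeasurable (fun x => T x p) μ :=
    (ContinuousLinearMap.apply ℝ E p).continuous.comp_aestronglyMeasurable hT
  have hmeas {F G : Type u} [NormedAddCommGroup F] [NormedSpace ℝ F] [NormedAddCommGroup G]
      [NormedSpace ℝ G] {f : E → F} (hf : Continuous f) {L : X → F →L[ℝ] G}
      (hL : Integrable L μ) (p : P) : AEStronglyMeasurable (fun x => L x (f (T x p))) μ :=
    (isBoundedBilinearMap_apply (𝕜 := ℝ) (E := F) (F := G)).continuous.comp_aestronglyMeasurable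
      (hL.aestronglyMeasurable.prodMk (hf.comp_aestronglyMeasurable (hTp p)))
  induction r with
  | zero =>
    intro F G _ _ _ _ f hf L hL
    simp only [Nat.cast_zero, contDiff_zero] at hf ⊢
    refine continuous_iff_continuousAt.2 fun p₀ => ?_
    obtain ⟨C, hC⟩ := hf.exists_norm_comp_clm_le hM p₀
    refine continuousAt_of_dominated (bound := fun x => ‖L x‖ * C)
      (Eventually.of_forall fun p => hmeas hf hL p) ?_ (hL.norm.mul_const C) ?_
    · filter_upwards [Metric.ball_mem_nhds p₀ one_pos] with p hp
      exact Eventually.of_forall fun x => ((L x).le_opNorm _).trans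
        (mul_le_mul_of_nonneg_left (hC p hp x) (norm_nonneg _))
    · exact Eventually.of_forall fun x => by fun_prop
  | succ r ih =>
    intro F G _ _ _ _ f hf L hL
    obtain ⟨f', hf', hff'⟩ := contDiff_succ_iff_hasFDerivAt.1 (by exact_mod_cast hf)
    let L' : X → (E →L[ℝ] F) →L[ℝ] P →L[ℝ] G := fun x =>
      (ContinuousLinearMap.compL ℝ P F G (L x)).comp
        ((ContinuousLinearMap.compL ℝ P E F).flip (T x))
    have hL'meas : AEStronglyMeasurable L' μ := by
      have : Continuous fun q : (F →L[ℝ] G) × (P →L[ℝ] E) =>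
          (ContinuousLinearMap.compL ℝ P F G q.1).comp
            ((ContinuousLinearMap.compL ℝ P E F).flip q.2) := by fun_prop
      exact this.comp_aestronglyMeasurable (hL.aestronglyMeasurable.prodMk hT)
    have hL' : Integrable L' μ := by
      refine (hL.norm.mul_const M).mono' hL'meas (Eventually.of_forall fun x => ?_)
      have hM0 := (norm_nonneg _).trans (hM x)
      refine ContinuousLinearMap.opNorm_le_bound _ (by positivity) fun A => ?_
      calc ‖(L x).comp (A.comp (T x))‖ ≤ ‖L x‖ * ‖A.comp (T x)‖ :=
            ContinuousLinearMap.opNorm_comp_le _ _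
        _ ≤ ‖L x‖ * (‖A‖ * ‖T x‖) := by gcongr; exact ContinuousLinearMap.opNorm_comp_le _ _
        _ ≤ ‖L x‖ * (‖A‖ * M) := by gcongr; exact hM x
        _ = ‖L x‖ * M * ‖A‖ := by ring
    rw [Nat.cast_succ, contDiff_succ_iff_hasFDerivAt]
    refine ⟨_, ih hf' hL', fun p₀ => ?_⟩
    have hfc := hf.continuous
    obtain ⟨C, hC⟩ := hfc.exists_norm_comp_clm_le hM p₀
    obtain ⟨C', hC'⟩ := hf'.continuous.exists_norm_comp_clm_le hM p₀
    refine hasFDerivAt_integral_of_dominated_of_fderiv_le (bound := fun x => ‖L' x‖ * C')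
      (F' := fun p x => L' x (f' (T x p)))
      (Metric.ball_mem_nhds p₀ one_pos) (Eventually.of_forall fun p => hmeas hfc hL p) ?_
      (hmeas hf'.continuous hL' p₀) ?_ (hL'.norm.mul_const C') ?_
    · exact (hL.norm.mul_const C).mono' (hmeas hfc hL p₀) (Eventually.of_forall fun x =>
        ((L x).le_opNorm _).trans (mul_le_mul_of_nonneg_left
          (hC p₀ (Metric.mem_ball_self one_pos) x) (norm_nonneg _)))
    · exact Eventually.of_forall fun x p hp => ((L' x).le_opNorm _).trans
        (mul_le_mul_of_nonneg_left (hC' p hp x) (norm_nonneg _))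
    · exact Eventually.of_forall fun x p _ =>
        (L x).hasFDerivAt.comp p ((hff' _).comp p (T x).hasFDerivAt)

theorem exists_finset_forall_eq_sum_mul {X : Type*} (W : Submodule ℝ (X → ℝ))
    [FiniteDimensional ℝ W] :
    ∃ (t : Finset X) (q : X → W), ∀ g ∈ W, ∀ x, g x = ∑ y ∈ t, g y * (q y : X → ℝ) x := by
  classical
  let ev : X → Module.Dual ℝ W := fun x => (LinearMap.proj x).comp W.subtype
  have hev : Submodule.span ℝ (range ev) = ⊤ := by
    apply Submodule.span_eq_top_of_ne_zero
    intro z hz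
    by_contra! h
    exact hz (Subtype.ext (funext fun x => h (ev x) (mem_range_self x)))
  let b := Module.finBasis ℝ W
  have hc : ∀ k, ∃ c : X →₀ ℝ, (c.sum fun i a => a • ev i) = b.coord k := fun k =>
    Finsupp.mem_span_range_iff_exists_finsupp.1 (hev ▸ Submodule.mem_top)
  choose c hc using hc
  refine ⟨Finset.univ.biUnion fun k => (c k).support, fun y => ∑ k, c k y • b k, fun g hg x => ?_⟩
  have hk (k) : b.repr ⟨g, hg⟩ k =
      ∑ y ∈ Finset.univ.biUnion fun k => (c k).support, c k y * g y := by
    have h := LinearMap.congr_fun (hc k) ⟨g, hg⟩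
    rw [Module.Basis.coord_apply] at h
    rw [← h, Finsupp.sum_of_support_subset (c k)
      (Finset.subset_biUnion_of_mem (fun k => (c k).support) (Finset.mem_univ k)) _ (by simp)]
    simp [ev, LinearMap.sum_apply]
  have h := congrArg (fun w : W => (w : X → ℝ) x) (b.sum_repr ⟨g, hg⟩)
  simp only [hk] at h
  simp only [Submodule.coe_sum, Submodule.coe_smul, Finset.sum_apply, Pi.smul_apply,
    smul_eq_mul] at h ⊢
  rw [← h]
  simp only [Finset.sum_mul, Finset.mul_sum]
  rw [Finset.sum_comm]
  exact Finset.sum_congr rfl fun y _ => Finset.sum_congr rfl fun k _ => by ring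

theorem ContinuousLinearMap.det_nonneg_of_inner_nonneg {E : Type*} [NormedAddCommGroup E]
    [InnerProductSpace ℝ E] [FiniteDimensional ℝ E] {A : E →L[ℝ] E}
    (hA : ∀ v, 0 ≤ inner ℝ (A v) v) : 0 ≤ A.det := by
  by_contra! hneg
  let B : ℝ → E →L[ℝ] E := fun t => A + t • (ContinuousLinearMap.id ℝ E - A)
  have hcont : Continuous fun t => (B t).det :=
    ContinuousLinearMap.continuous_det.comp (by fun_prop)
  have h0 : (B 0).det = A.det := by simp [B]
  have h1 : (B 1).det = 1 := by simp [B, ContinuousLinearMap.det]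
  obtain ⟨t, ht, hdet⟩ := intermediate_value_Icc zero_le_one hcont.continuousOn
    (show (0 : ℝ) ∈ Icc (B 0).det (B 1).det by rw [h0, h1]; exact ⟨hneg.le, zero_le_one⟩)
  have ht0 : 0 < t := lt_of_le_of_ne ht.1 (by rintro rfl; exact hneg.ne (h0.symm.trans hdet))
  obtain ⟨v, hv, hv0⟩ := (Submodule.ne_bot_iff _).1 (LinearMap.bot_lt_ker_of_det_eq_zero hdet).ne'
  have hv' : A v + t • (v - A v) = 0 := hv
  have h := congrArg (fun w => inner ℝ w v) hv'
  simp only [inner_add_left, inner_smul_left, inner_sub_left, inner_zero_left] at h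
  have hpos : 0 < inner ℝ v v := real_inner_self_pos.2 hv0
  have := hA v
  simp at h
  nlinarith [ht.2, mul_nonneg (sub_nonneg.2 ht.2) this, mul_pos ht0 hpos,
    real_inner_self_eq_norm_sq v]

/-- The determinant is a homogeneous polynomial in the coefficients of a linear combination. -/
theorem LinearMap.exists_det_sum_smul_eq {E ι : Type*} [AddCommGroup E] [Module ℝ E]
    [FiniteDimensional ℝ E] [Fintype ι] (A : ι → E →ₗ[ℝ] E) :
    ∃ c : (Fin (Module.finrank ℝ E) → ι) → ℝ, ∀ lam : ι → ℝ,
      LinearMap.det (∑ i, lam i • A i) = ∑ σ, c σ * ∏ j, lam (σ j) := by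
  let b := Module.finBasis ℝ E
  refine ⟨fun σ => Matrix.detRowAlternating fun j => LinearMap.toMatrix b b (A (σ j)) j,
    fun lam => ?_⟩
  have h : LinearMap.toMatrix b b (∑ i, lam i • A i)
      = fun j => ∑ i, lam i • LinearMap.toMatrix b b (A i) j := by
    ext j k
    simp [Matrix.sum_apply]
  rw [← LinearMap.det_toMatrix b, h]
  refine ((Matrix.detRowAlternating : ((Fin _ → ℝ) [⋀^Fin _]→ₗ[ℝ] ℝ)).toMultilinearMap.map_sum
    (fun j i => lam i • LinearMap.toMatrix b b (A i) j)).trans ?_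
  refine Finset.sum_congr rfl fun σ _ => ?_
  refine (MultilinearMap.map_smul_univ _ (fun j => lam (σ j)) _).trans ?_
  rw [smul_eq_mul, mul_comm]
  rfl

namespace ConvexBody

variable {E : Type*} [NormedAddCommGroup E] [InnerProductSpace ℝ E] (K : ConvexBody E)

theorem exists_nearest (x : E) : ∃ y ∈ K, ∀ z ∈ K, inner ℝ (x - y) (z - y) ≤ 0 := by
  obtain ⟨y, hy, h⟩ :=
    exists_norm_eq_iInf_of_complete_convex K.nonempty K.isCompact.isComplete K.convex x
  exact ⟨y, hy, (norm_eq_iInf_iff_real_inner_le_zero K.convex hy).1 h⟩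

/-- The nearest-point projection onto a convex body. -/
def proj (x : E) : E := (K.exists_nearest x).choose

theorem proj_mem (x : E) : K.proj x ∈ K := (K.exists_nearest x).choose_spec.1

theorem inner_sub_proj_le (x : E) {z : E} (hz : z ∈ K) :
    inner ℝ (x - K.proj x) (z - K.proj x) ≤ 0 :=
  (K.exists_nearest x).choose_spec.2 z hz

theorem proj_firmly_nonexpansive (x y : E) :
    ‖K.proj x - K.proj y‖ ^ 2 ≤ inner ℝ (K.proj x - K.proj y) (x - y) := by
  have h₁ := K.inner_sub_proj_le x (K.proj_mem y)
  have h₂ := K.inner_sub_proj_le y (K.proj_mem x)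
  rw [← real_inner_self_eq_norm_sq]
  simp only [inner_sub_left, inner_sub_right] at *
  simp only [real_inner_comm (K.proj x) x, real_inner_comm (K.proj x) y,
    real_inner_comm (K.proj y) x, real_inner_comm (K.proj y) y,
    real_inner_comm (K.proj x) (K.proj y)] at *
  linarith

theorem lipschitzWith_proj : LipschitzWith 1 K.proj := by
  refine LipschitzWith.of_dist_le_mul fun x y => ?_
  rw [NNReal.coe_one, one_mul, dist_eq_norm, dist_eq_norm]
  have h := (K.proj_firmly_nonexpansive x y).trans (real_inner_le_norm _ _)
  rcases (norm_nonneg (K.proj x - K.proj y)).eq_or_lt with h0 | h0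
  · rw [← h0]; exact norm_nonneg _
  · rw [sq] at h
    exact le_of_mul_le_mul_left h h0

theorem proj_eq_of_forall_inner_le {x y : E} (hy : y ∈ K)
    (h : ∀ z ∈ K, inner ℝ (x - y) (z - y) ≤ 0) : K.proj x = y := by
  have h₁ := K.inner_sub_proj_le x hy
  have h₂ := h _ (K.proj_mem x)
  rw [← sub_eq_zero, ← norm_eq_zero, ← sq_eq_zero_iff, ← real_inner_self_eq_norm_sq]
  refine le_antisymm ?_ real_inner_self_nonneg
  simp only [inner_sub_left, inner_sub_right] at *
  simp only [real_inner_comm (K.proj x) y] at *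
  linarith

/-- The fibres of the projection are convex. -/
theorem proj_add_smul_sub {x y : E} (h : K.proj x = K.proj y) {t : ℝ} (ht : t ∈ Icc (0 : ℝ) 1) :
    K.proj (x + t • (y - x)) = K.proj x := by
  refine K.proj_eq_of_forall_inner_le (K.proj_mem x) fun z hz => ?_
  have h₁ := K.inner_sub_proj_le x hz
  have h₂ := K.inner_sub_proj_le y hz
  rw [← h] at h₂
  have : x + t • (y - x) - K.proj x = (1 - t) • (x - K.proj x) + t • (y - K.proj x) := by
    module
  rw [this, inner_add_left, inner_smul_left, inner_smul_left]
  simp only [conj_trivial]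
  nlinarith [mul_nonneg (sub_nonneg.2 ht.2) (neg_nonneg.2 h₁), mul_nonneg ht.1 (neg_nonneg.2 h₂)]

theorem inner_fderiv_proj_nonneg (x v : E) : 0 ≤ inner ℝ (fderiv ℝ K.proj x v) v := by
  by_cases hd : DifferentiableAt ℝ K.proj x
  · have h : HasDerivAt (fun t : ℝ => K.proj (x + t • v)) (fderiv ℝ K.proj x v) 0 := by
      have h₂ : HasDerivAt (fun t : ℝ => x + t • v) v 0 := by
        simpa using ((hasDerivAt_id (0 : ℝ)).smul_const v).const_add x
      exact HasFDerivAt.comp_hasDerivAt (𝕜 := ℝ) (0 : ℝ)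
        (by simpa using hd.hasFDerivAt) h₂
    have hslope := (hasDerivAt_iff_tendsto_slope.1 h).mono_left
      (nhdsWithin_mono 0 (show Ioi (0 : ℝ) ⊆ {0}ᶜ from fun _ ht => ne_of_gt ht))
    refine ge_of_tendsto (hslope.inner tendsto_const_nhds) ?_
    filter_upwards [self_mem_nhdsWithin] with t ht
    have ht : 0 < t := ht
    have hm := (sq_nonneg _).trans (K.proj_firmly_nonexpansive (x + t • v) x)
    rw [add_sub_cancel_left, inner_smul_right] at hm
    rw [slope_def_module, sub_zero, zero_smul, add_zero, inner_smul_left]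
    exact mul_nonneg (inv_nonneg.2 ht.le) (nonneg_of_mul_nonneg_right hm ht)
  · simp [fderiv_zero_of_not_differentiableAt hd]

end ConvexBody

theorem LipschitzWith.addHaar_image_eq_zero {E : Type*} [NormedAddCommGroup E] [NormedSpace ℝ E]
    [FiniteDimensional ℝ E] [MeasurableSpace E] [BorelSpace E] (μ : Measure E)
    [μ.IsAddHaarMeasure] {C : NNReal} {f : E → E} (hf : LipschitzWith C f) {s : Set E}
    (hs : μ s = 0) : μ (f '' s) = 0 := by
  let d := Module.finrank ℝ E
  have h₁ : (μH[d] : Measure E) ≪ μ := Measure.absolutelyContinuous_isAddHaarMeasure _ _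
  have h₂ : μ ≪ (μH[d] : Measure E) := Measure.absolutelyContinuous_isAddHaarMeasure _ _
  refine h₂ (le_antisymm ?_ zero_le)
  simpa [h₁ hs] using hf.hausdorffMeasure_image_le (d := d) (by positivity) s

namespace ConvexBody

variable {E ι : Type*} [NormedAddCommGroup E] [InnerProductSpace ℝ E] [Fintype ι]
  (K : ι → ConvexBody E)

theorem inner_sub_half_sq_le (K : ConvexBody E) (x : E) {k : E} (hk : k ∈ K) :
    inner ℝ x k - ‖k‖ ^ 2 / 2 ≤ inner ℝ x (K.proj x) - ‖K.proj x‖ ^ 2 / 2 := by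
  have h := K.inner_sub_proj_le x hk
  have h' := real_inner_self_nonneg (x := k - K.proj x)
  simp only [← real_inner_self_eq_norm_sq]
  simp only [inner_sub_left, inner_sub_right] at *
  simp only [real_inner_comm (K.proj x) k] at *
  linarith

theorem mem_sum_smul {lam : ι → ℝ} {v : E} :
    v ∈ ∑ i, lam i • (K i : Set E) ↔ ∃ k : ι → E, (∀ i, k i ∈ K i) ∧ ∑ i, lam i • k i = v := by
  rw [Set.mem_fintype_sum]
  constructor
  · rintro ⟨g, hg, rfl⟩
    choose k hk hkg using fun i => Set.mem_smul_set.1 (hg i)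
    exact ⟨k, hk, Finset.sum_congr rfl fun i _ => hkg i⟩
  · rintro ⟨k, hk, rfl⟩
    exact ⟨fun i => lam i • k i, fun i => Set.smul_mem_smul_set (hk i), rfl⟩

theorem isCompact_sum_smul (lam : ι → ℝ) : IsCompact (∑ i, lam i • (K i : Set E)) := by
  have : ∑ i, lam i • (K i : Set E)
      = (fun k : ι → E => ∑ i, lam i • k i) '' univ.pi fun i => (K i : Set E) := by
    ext v
    simp [mem_sum_smul]
  rw [this]
  exact (isCompact_univ_pi fun i => (K i).isCompact).image (by fun_prop)

theorem convex_sum_smul (lam : ι → ℝ) : Convex ℝ (∑ i, lam i • (K i : Set E)) :=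
  Finset.sum_induction _ (Convex ℝ) (fun _ _ => Convex.add) (convex_singleton 0)
    fun i _ => (K i).convex.smul (lam i)

theorem sum_smul_proj_mem (lam : ι → ℝ) (x : E) :
    ∑ i, lam i • (K i).proj x ∈ ∑ i, lam i • (K i : Set E) :=
  (mem_sum_smul K).2 ⟨_, fun i => (K i).proj_mem x, rfl⟩

theorem interior_sum_smul_subset_range [FiniteDimensional ℝ E] {lam : ι → ℝ}
    (hlam : ∀ i, 0 ≤ lam i) :
    interior (∑ i, lam i • (K i : Set E)) ⊆ range fun x => ∑ i, lam i • (K i).proj x := by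
  have := FiniteDimensional.proper_real E
  intro v hv
  obtain ⟨ε, hε, hball⟩ := Metric.isOpen_iff.1 isOpen_interior v hv
  have hcont (i) : Continuous (K i).proj := (K i).lipschitzWith_proj.continuous
  let u : E → ℝ := fun x =>
    ∑ i, lam i * (inner ℝ x ((K i).proj x) - ‖(K i).proj x‖ ^ 2 / 2) - inner ℝ x v
  have hu : Continuous u := by fun_prop
  choose R hR using fun i => (K i).isCompact.isBounded.exists_norm_le
  have hlower (x : E) : ε / 2 * ‖x‖ - ∑ i, lam i * (R i ^ 2 / 2) ≤ u x := by
    let w := (ε / 2) • ‖x‖⁻¹ • x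
    have hw : v + w ∈ ∑ i, lam i • (K i : Set E) := by
      refine interior_subset (hball ?_)
      rw [mem_ball_iff_norm, add_sub_cancel_left, norm_smul, norm_smul, norm_inv, norm_norm,
        Real.norm_of_nonneg (by positivity)]
      have : ‖x‖⁻¹ * ‖x‖ ≤ 1 := inv_mul_le_one
      nlinarith
    obtain ⟨k, hk, hkw⟩ := (mem_sum_smul K).1 hw
    have hxw : inner ℝ x w = ε / 2 * ‖x‖ := by
      rw [inner_smul_right, inner_smul_right, real_inner_self_eq_norm_sq]
      rcases eq_or_ne ‖x‖ 0 with h | h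
      · simp [h]
      · field_simp
    have hsum : ∑ i, lam i * inner ℝ x (k i) = inner ℝ x v + ε / 2 * ‖x‖ := by
      rw [← hxw, ← inner_add_right, ← hkw, inner_sum]
      simp only [inner_smul_right]
    have hle : ∑ i, lam i * (inner ℝ x (k i) - R i ^ 2 / 2)
        ≤ ∑ i, lam i * (inner ℝ x ((K i).proj x) - ‖(K i).proj x‖ ^ 2 / 2) := by
      refine Finset.sum_le_sum fun i _ => mul_le_mul_of_nonneg_left ?_ (hlam i)
      refine le_trans ?_ ((K i).inner_sub_half_sq_le x (hk i))
      have := pow_le_pow_left₀ (norm_nonneg _) (hR i _ (hk i)) 2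
      linarith
    simp only [mul_sub, Finset.sum_sub_distrib] at hle hsum
    simp only [u, mul_sub, Finset.sum_sub_distrib]
    linarith
  have hcoercive : Tendsto u (cocompact E) atTop := by
    refine tendsto_atTop_mono hlower ?_
    exact tendsto_atTop_add_const_right _ _
      ((tendsto_norm_cocompact_atTop (E := E)).const_mul_atTop (half_pos hε))
  obtain ⟨x, hx⟩ := hu.exists_forall_le hcoercive
  refine ⟨x, ?_⟩
  have hdir (w : E) : 0 ≤ inner ℝ w (∑ i, lam i • (K i).proj x - v) := by
    have hlim : Tendsto (fun t : ℝ => inner ℝ w (∑ i, lam i • (K i).proj (x + t • w) - v))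
        (nhdsWithin 0 (Ioi 0)) (nhds (inner ℝ w (∑ i, lam i • (K i).proj x - v))) := by
      have : Continuous fun t : ℝ => inner ℝ w (∑ i, lam i • (K i).proj (x + t • w) - v) := by
        fun_prop
      simpa using (this.tendsto 0).mono_left nhdsWithin_le_nhds
    refine ge_of_tendsto hlim ?_
    filter_upwards [self_mem_nhdsWithin] with t ht
    refine nonneg_of_mul_nonneg_right (a := t) ?_ ht
    have hle : ∑ i, lam i * (inner ℝ x ((K i).proj (x + t • w)) - ‖(K i).proj (x + t • w)‖ ^ 2 / 2)
        ≤ ∑ i, lam i * (inner ℝ x ((K i).proj x) - ‖(K i).proj x‖ ^ 2 / 2) :=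
      Finset.sum_le_sum fun i _ => mul_le_mul_of_nonneg_left
        ((K i).inner_sub_half_sq_le x ((K i).proj_mem _)) (hlam i)
    have hmin := hx (x + t • w)
    simp only [u, inner_add_left, inner_smul_left, conj_trivial, mul_sub, mul_add,
      Finset.sum_sub_distrib, Finset.sum_add_distrib] at hle hmin
    simp only [inner_sub_right, inner_sum, inner_smul_right, mul_sub, Finset.mul_sum]
    simp only [mul_left_comm t]
    linarith
  have h := hdir (-(∑ i, lam i • (K i).proj x - v))
  rw [inner_neg_left, neg_nonneg] at h
  exact sub_eq_zero.1 (real_inner_self_nonpos.1 h)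

theorem det_sum_smul_fderiv_proj_nonneg [FiniteDimensional ℝ E] {lam : ι → ℝ}
    (hlam : ∀ i, 0 ≤ lam i) (x : E) : 0 ≤ (∑ i, lam i • fderiv ℝ (K i).proj x).det := by
  refine ContinuousLinearMap.det_nonneg_of_inner_nonneg fun v => ?_
  simp only [sum_apply, smul_apply, sum_inner,
    inner_smul_left, conj_trivial]
  exact Finset.sum_nonneg fun i _ => mul_nonneg (hlam i) ((K i).inner_fderiv_proj_nonneg x v)

/-- The points where the Minkowski combination of projections is a local diffeomorphism. -/
def regularSet (lam : ι → ℝ) : Set E :=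
  {x | (∀ i, DifferentiableAt ℝ (K i).proj x) ∧ (∑ i, lam i • fderiv ℝ (K i).proj x).det ≠ 0}

theorem hasFDerivAt_sum_smul_proj (lam : ι → ℝ) {x : E}
    (hx : ∀ i, DifferentiableAt ℝ (K i).proj x) :
    HasFDerivAt (fun x => ∑ i, lam i • (K i).proj x) (∑ i, lam i • fderiv ℝ (K i).proj x) x :=
  HasFDerivAt.fun_sum fun i _ => (hx i).hasFDerivAt.const_smul (lam i)

theorem injOn_regularSet [FiniteDimensional ℝ E] {lam : ι → ℝ} (hlam : ∀ i, 0 ≤ lam i) :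
    InjOn (fun x => ∑ i, lam i • (K i).proj x) (regularSet K lam) := by
  intro x hx y _ hxy
  have hsum : ∑ i, lam i * inner ℝ ((K i).proj x - (K i).proj y) (x - y) = 0 := by
    have h : inner ℝ (∑ i, lam i • (K i).proj x - ∑ i, lam i • (K i).proj y) (x - y) = (0 : ℝ) := by
      rw [sub_eq_zero.2 hxy, inner_zero_left]
    rw [← h, ← Finset.sum_sub_distrib, sum_inner]
    simp only [← smul_sub, inner_smul_left, conj_trivial]
  have hterm (i) : lam i = 0 ∨ (K i).proj x = (K i).proj y := by
    have hi := (Finset.sum_eq_zero_iff_of_nonneg fun i _ => mul_nonneg (hlam i)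
      ((sq_nonneg _).trans ((K i).proj_firmly_nonexpansive x y))).1 hsum i (Finset.mem_univ i)
    refine (mul_eq_zero.1 hi).imp_right fun h => ?_
    have := (K i).proj_firmly_nonexpansive x y
    rw [h] at this
    exact sub_eq_zero.1 (norm_eq_zero.1 (pow_eq_zero_iff two_ne_zero |>.1
      (le_antisymm this (sq_nonneg _))))
  have hconst : ∀ t ∈ Icc (0 : ℝ) 1,
      ∑ i, lam i • (K i).proj (x + t • (y - x)) = ∑ i, lam i • (K i).proj x := fun t ht =>
    Finset.sum_congr rfl fun i _ => by
      rcases hterm i with h | h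
      · rw [h, zero_smul, zero_smul]
      · rw [(K i).proj_add_smul_sub h ht]
  have hderiv : (∑ i, lam i • fderiv ℝ (K i).proj x) (y - x) = 0 := by
    have h₂ : HasDerivAt (fun t : ℝ => x + t • (y - x)) (y - x) 0 := by
      simpa using ((hasDerivAt_id (0 : ℝ)).smul_const (y - x)).const_add x
    have h₃ : HasDerivAt (fun t : ℝ => ∑ i, lam i • (K i).proj (x + t • (y - x)))
        ((∑ i, lam i • fderiv ℝ (K i).proj x) (y - x)) 0 :=
      HasFDerivAt.comp_hasDerivAt (𝕜 := ℝ) (l := fun z => ∑ i, lam i • (K i).proj z) (0 : ℝ)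
        (by simpa using hasFDerivAt_sum_smul_proj K lam hx.1) h₂
    have h₄ : HasDerivWithinAt (fun t : ℝ => ∑ i, lam i • (K i).proj (x + t • (y - x)))
        0 (Icc 0 1) 0 :=
      (hasDerivWithinAt_const (0 : ℝ) (Icc (0 : ℝ) 1) (∑ i, lam i • (K i).proj x)).congr
        hconst (hconst 0 (by simp))
    exact (uniqueDiffOn_Icc_zero_one 0 (by simp)).eq_deriv _ h₃.hasDerivWithinAt h₄
  by_contra hne
  refine hx.2 (LinearMap.det_eq_zero_iff_ker_ne_bot.2 fun hbot => hne ?_)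
  have hmem : y - x ∈ LinearMap.ker
      ((∑ i, lam i • fderiv ℝ (K i).proj x : E →L[ℝ] E) : E →ₗ[ℝ] E) := hderiv
  rw [hbot, Submodule.mem_bot, sub_eq_zero] at hmem
  exact hmem.symm

variable [FiniteDimensional ℝ E] [MeasurableSpace E] [BorelSpace E]

theorem measurable_det_sum_smul_fderiv_proj (lam : ι → ℝ) :
    Measurable fun x => (∑ i, lam i • fderiv ℝ (K i).proj x).det := by
  have := FiniteDimensional.complete ℝ E
  exact ContinuousLinearMap.continuous_det.measurable.comp
    (Finset.measurable_sum _ fun i _ => (measurable_fderiv ℝ _).const_smul (lam i))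

theorem measurableSet_regularSet (lam : ι → ℝ) : MeasurableSet (regularSet K lam) := by
  have := FiniteDimensional.complete ℝ E
  have hD : MeasurableSet {x | ∀ i, DifferentiableAt ℝ (K i).proj x} := by
    rw [ofPred_forall]
    exact MeasurableSet.iInter fun i => measurableSet_of_differentiableAt ℝ _
  exact hD.inter (measurable_det_sum_smul_fderiv_proj K lam
    (measurableSet_singleton (0 : ℝ)).compl)

variable (μ : Measure E) [μ.IsAddHaarMeasure]

theorem ae_differentiableAt_proj : ∀ᵐ x ∂μ, ∀ i, DifferentiableAt ℝ (K i).proj x :=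
  ae_all_iff.2 fun i => (K i).lipschitzWith_proj.ae_differentiableAt

theorem image_regularSet_ae_eq {lam : ι → ℝ} (hlam : ∀ i, 0 ≤ lam i) :
    (fun x => ∑ i, lam i • (K i).proj x) '' regularSet K lam
      =ᵐ[μ] (∑ i, lam i • (K i : Set E) : Set E) := by
  let Φ : E → E := fun x => ∑ i, lam i • (K i).proj x
  let D : Set E := {x | ∀ i, DifferentiableAt ℝ (K i).proj x}
  let Z : Set E := D ∩ {x | (∑ i, lam i • fderiv ℝ (K i).proj x).det = 0}
  have hΦ : LipschitzWith (∑ i, ‖lam i‖₊) Φ := by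
    refine LipschitzWith.of_dist_le_mul fun x y => (dist_sum_sum_le _ _ _).trans ?_
    rw [NNReal.coe_sum, Finset.sum_mul]
    refine Finset.sum_le_sum fun i _ => (dist_smul_le _ _ _).trans ?_
    rw [coe_nnnorm]
    simpa using mul_le_mul_of_nonneg_left ((K i).lipschitzWith_proj.dist_le_mul x y)
      (norm_nonneg (lam i))
  have h₁ : μ (Φ '' Dᶜ) = 0 := hΦ.addHaar_image_eq_zero μ (ae_differentiableAt_proj K μ)
  have h₂ : μ (Φ '' Z) = 0 := addHaar_image_eq_zero_of_det_fderivWithin_eq_zero μ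
    (fun x hx => (hasFDerivAt_sum_smul_proj K lam hx.1).hasFDerivWithinAt) fun x hx => hx.2
  have h₃ := (convex_sum_smul K lam).addHaar_frontier μ
  refine (LE.le.eventuallyLE ?_).antisymm ?_
  · rintro _ ⟨x, _, rfl⟩
    exact sum_smul_proj_mem K lam x
  · rw [ae_le_set]
    refine measure_mono_null ?_ (measure_union_null h₃ (measure_union_null h₁ h₂))
    rintro v ⟨hv, hv'⟩
    by_cases hint : v ∈ interior (∑ i, lam i • (K i : Set E))
    · obtain ⟨x, rfl⟩ := interior_sum_smul_subset_range K hlam hint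
      refine Or.inr ?_
      by_cases hxD : x ∈ D
      · refine Or.inr ⟨x, ⟨hxD, ?_⟩, rfl⟩
        by_contra h
        exact hv' ⟨x, ⟨hxD, h⟩, rfl⟩
      · exact Or.inl ⟨x, hxD, rfl⟩
    · exact Or.inl ⟨subset_closure hv, hint⟩

theorem ae_notMem_regularSet_imp_det_eq_zero (lam : ι → ℝ) :
    ∀ᵐ x ∂μ, x ∉ regularSet K lam → (∑ i, lam i • fderiv ℝ (K i).proj x).det = 0 := by
  filter_upwards [ae_differentiableAt_proj K μ] with x hx hxS
  by_contra h
  exact hxS ⟨hx, h⟩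

theorem integrable_det_sum_smul_fderiv_proj {lam : ι → ℝ} (hlam : ∀ i, 0 ≤ lam i) :
    Integrable (fun x => (∑ i, lam i • fderiv ℝ (K i).proj x).det) μ := by
  have h := (integrableOn_image_iff_integrableOn_abs_det_fderiv_smul μ
    (measurableSet_regularSet K lam)
    (fun x hx => (hasFDerivAt_sum_smul_proj K lam hx.1).hasFDerivWithinAt)
    (injOn_regularSet K hlam) (fun _ => (1 : ℝ))).1
      ((integrableOn_congr_set_ae (image_regularSet_ae_eq K μ hlam)).2
        (continuousOn_const.integrableOn_compact (isCompact_sum_smul K lam)))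
  simp only [abs_of_nonneg (det_sum_smul_fderiv_proj_nonneg K hlam _), smul_eq_mul, mul_one] at h
  exact IntegrableOn.integrable_of_ae_notMem_eq_zero h
    (ae_notMem_regularSet_imp_det_eq_zero K μ lam)

/-- The integral over a Minkowski combination, parametrized by the nearest-point projections. -/
theorem setIntegral_sum_smul {F : Type*} [NormedAddCommGroup F] [NormedSpace ℝ F] {lam : ι → ℝ}
    (hlam : ∀ i, 0 ≤ lam i) (f : E → F) :
    ∫ x in ∑ i, lam i • (K i : Set E), f x ∂μ
      = ∫ x, (∑ i, lam i • fderiv ℝ (K i).proj x).det • f (∑ i, lam i • (K i).proj x) ∂μ := by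
  rw [← setIntegral_congr_set (image_regularSet_ae_eq K μ hlam),
    integral_image_eq_integral_abs_det_fderiv_smul μ (measurableSet_regularSet K lam)
      (fun x hx => (hasFDerivAt_sum_smul_proj K lam hx.1).hasFDerivWithinAt)
      (injOn_regularSet K hlam)]
  simp only [abs_of_nonneg (det_sum_smul_fderiv_proj_nonneg K hlam _)]
  refine setIntegral_eq_integral_of_ae_compl_eq_zero ?_
  filter_upwards [ae_notMem_regularSet_imp_det_eq_zero K μ lam] with x hx hxS
  rw [hx hxS, zero_smul]

end ConvexBody

/-- The closed orthant `ℝ_{≥0}^ι`. -/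
abbrev closedOrthant (ι : Type*) : Set (ι → ℝ) := {lam | ∀ i, 0 ≤ lam i}

/-- Homogeneous polynomials of degree `d`, as functions on the closed orthant. -/
def orthantPolynomials (ι : Type*) (d : ℕ) : Submodule ℝ (closedOrthant ι → ℝ) :=
  Submodule.span ℝ (range fun (σ : Fin d → ι) (lam : closedOrthant ι) => ∏ j, lam.1 (σ j))

instance (ι : Type*) [Finite ι] (d : ℕ) : FiniteDimensional ℝ (orthantPolynomials ι d) :=
  FiniteDimensional.span_of_finite ℝ (finite_range _)

theorem exists_contDiff_of_mem_orthantPolynomials {ι : Type*} [Fintype ι] {d : ℕ}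
    {g : closedOrthant ι → ℝ} (hg : g ∈ orthantPolynomials ι d) :
    ∃ q : (ι → ℝ) → ℝ, (∀ m : WithTop ℕ∞, ContDiff ℝ m q) ∧
      ∀ lam : closedOrthant ι, q lam = g lam := by
  refine Submodule.span_induction ?_ ?_ ?_ ?_ hg
  · rintro _ ⟨σ, rfl⟩
    exact ⟨fun lam => ∏ j, lam (σ j), fun m => by fun_prop, fun _ => rfl⟩
  · exact ⟨0, fun _ => contDiff_const, fun _ => rfl⟩
  · rintro _ _ _ _ ⟨q₁, h₁, h₁'⟩ ⟨q₂, h₂, h₂'⟩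
    exact ⟨q₁ + q₂, fun m => (h₁ m).add (h₂ m), fun lam => by simp [h₁', h₂']⟩
  · rintro a _ _ ⟨q, h, h'⟩
    exact ⟨a • q, fun m => contDiff_const.smul (h m), fun lam => by simp [h']⟩

theorem ContinuousLinearMap.det_sum_smul_mem_orthantPolynomials {E ι : Type*}
    [NormedAddCommGroup E] [NormedSpace ℝ E] [FiniteDimensional ℝ E] [Fintype ι]
    (A : ι → E →L[ℝ] E) :
    (fun lam : closedOrthant ι => (∑ i, lam.1 i • A i).det)
      ∈ orthantPolynomials ι (Module.finrank ℝ E) := by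
  obtain ⟨c, hc⟩ := LinearMap.exists_det_sum_smul_eq fun i => (A i : E →ₗ[ℝ] E)
  have h : (fun lam : closedOrthant ι => (∑ i, lam.1 i • A i).det)
      = ∑ σ, c σ • fun lam : closedOrthant ι => ∏ j, lam.1 (σ j) := by
    funext lam
    simp [ContinuousLinearMap.det, hc]
  rw [h]
  exact Submodule.sum_mem _ fun σ _ => Submodule.smul_mem _ _
    (Submodule.subset_span (mem_range_self σ))

/-- For a `C^r` function `f` (with `r ∈ ℕ ∪ {∞}`) and convex bodies `K₁, …, K_s`, the function
`(λ₁, …, λ_s) ↦ ∫_{λ₁K₁ + ⋯ + λ_sK_s} f` is `C^r` on the closed orthant `ℝ_{≥0}^s`. -/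
theorem integral_over_minkowski_combination_contDiffOn {n : ℕ} (hn : 1 ≤ n)
    (r : ℕ∞) (f : Euc n → ℂ) (hf : ContDiff ℝ (r : WithTop ℕ∞) f)
    (s : ℕ) (K : Fin s → ConvexBody (Euc n)) :
    ContDiffOn ℝ (r : WithTop ℕ∞)
      (fun lam : Fin s → ℝ => ∫ x in (∑ i, lam i • (K i : Set (Euc n))), f x)
      {lam : Fin s → ℝ | ∀ i, 0 ≤ lam i} := by
  let J : Euc n → (Fin s → ℝ) → ℝ := fun x lam => (∑ i, lam i • fderiv ℝ (K i).proj x).det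
  have hJint {lam : Fin s → ℝ} (hlam : ∀ i, 0 ≤ lam i) : Integrable fun x => J x lam :=
    ConvexBody.integrable_det_sum_smul_fderiv_proj K volume hlam
  obtain ⟨t, q, hq⟩ :=
    exists_finset_forall_eq_sum_mul (orthantPolynomials (Fin s) (Module.finrank ℝ (Euc n)))
  choose Q hQ hQq using fun l => exists_contDiff_of_mem_orthantPolynomials (q l).2
  have hJ (x : Euc n) (lam : closedOrthant (Fin s)) : J x lam = ∑ l ∈ t, J x l * Q l lam := by
    simpa only [hQq] using
      hq _ (ContinuousLinearMap.det_sum_smul_mem_orthantPolynomials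
        fun i => fderiv ℝ (K i).proj x) lam
  let T : Euc n → (Fin s → ℝ) →L[ℝ] Euc n := fun x =>
    ∑ i, (ContinuousLinearMap.proj (R := ℝ) i).smulRight ((K i).proj x)
  have hTapp (x : Euc n) (lam : Fin s → ℝ) : T x lam = ∑ i, lam i • (K i).proj x := by simp [T]
  have hproj (i) : Continuous (K i).proj := (K i).lipschitzWith_proj.continuous
  have hT : Continuous T := continuous_finsetSum _ fun i _ =>
    (ContinuousLinearMap.smulRightL ℝ (Fin s → ℝ) (Euc n)
      (ContinuousLinearMap.proj i)).continuous.comp (hproj i)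
  choose R hR using fun i => (K i).isCompact.isBounded.exists_norm_le
  have hTbound (x : Euc n) : ‖T x‖ ≤ ∑ i, ‖ContinuousLinearMap.proj (R := ℝ)
      (φ := fun _ : Fin s => ℝ) i‖ * R i := by
    refine (norm_sum_le _ _).trans (Finset.sum_le_sum fun i _ => ?_)
    rw [ContinuousLinearMap.norm_smulRight_apply]
    exact mul_le_mul_of_nonneg_left (hR i _ ((K i).proj_mem x)) (norm_nonneg _)
  have hG (l : closedOrthant (Fin s)) :
      ContDiff ℝ (r : WithTop ℕ∞) fun lam => ∫ x, J x l • f (T x lam) := by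
    refine contDiff_iff_forall_nat_le.2 fun m hm => ?_
    exact contDiff_integral_clm_apply_comp hT.aestronglyMeasurable hTbound m
      (hf.of_le (by exact_mod_cast hm))
      ((hJint l.2).smul_const (ContinuousLinearMap.id ℝ ℂ))
  have hsum : ContDiff ℝ (r : WithTop ℕ∞)
      fun lam => ∑ l ∈ t, Q l lam • ∫ x, J x l • f (T x lam) :=
    ContDiff.sum fun l _ => (hQ l _).smul (hG l)
  refine hsum.contDiffOn.congr fun lam hlam => ?_
  rw [ConvexBody.setIntegral_sum_smul K volume hlam f]
  have hint (l : closedOrthant (Fin s)) : Integrable fun x => J x l • f (T x lam) := by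
    have hfc := hf.continuous
    obtain ⟨C, hC⟩ := hfc.exists_norm_comp_clm_le hTbound lam
    refine (hJint l.2).smul_bdd C ?_ ?_
    · exact (hfc.comp (hT.clm_apply continuous_const)).aestronglyMeasurable
    · exact Eventually.of_forall fun x => hC lam (Metric.mem_ball_self one_pos) x
  simp only [← integral_smul]
  refine Eq.trans ?_ (integral_finsetSum t fun l _ => (hint l).smul (Q l lam))
  refine integral_congr_ae (Eventually.of_forall fun x => ?_)
  have h := hJ x ⟨lam, hlam⟩
  simp only [← hTapp]
  refine (congrArg (· • f (T x lam)) h).trans ?_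
  rw [Finset.sum_smul]
  exact Finset.sum_congr rfl fun l _ => by rw [mul_comm, mul_smul]
end
end
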